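/- arXiv:1410.2423 — 10 statements merged into one kernel-verified Lean document; each statement's English description precedes it below -/
import Mathlib

section
/- Let d ≥ 1 be an integer and let a_1,…,a_d, b_1,…,b_d, c_1,…,c_d be real numbers with a_i < b_j < c_l for all indices. Set F(x) = ∏_{i=1}^d (x − a_i), G(x) = ∏_{i=1}^d (x − b_i), H(x) = ∏_{i=1}^d (x − c_i). If x, y ∈ ℂ satisfy x ≠ y and the vectors (F(x), G(x), H(x)) and (F(y), G(y), H(y)) in ℂ³ are ℂ-linearly dependent, then y = conj(x) (in particular x is not real). In other words, the rational simple Harnack parametrization identifies only pairs of complex-conjugate points, i.e. all its double points are solitary nodes. -/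
/-- A nonempty product of nonnegative reals is strictly monotone in its factors. -/
lemma prod_lt_prod_of_nonneg_of_nonempty {ι : Type*} {s : Finset ι} {f g : ι → ℝ}
    (hs : s.Nonempty) (hf : ∀ i ∈ s, 0 ≤ f i) (hfg : ∀ i ∈ s, f i < g i) :
    ∏ i ∈ s, f i < ∏ i ∈ s, g i := by
  by_cases h0 : ∃ i ∈ s, f i = 0
  · obtain ⟨i, hi, hfi⟩ := h0
    rw [Finset.prod_eq_zero hi hfi]
    exact Finset.prod_pos fun j hj => (hf j hj).trans_lt (hfg j hj)
  · push Not at h0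
    exact Finset.prod_lt_prod_of_nonempty (fun i hi => (hf i hi).lt_of_ne' (h0 i hi)) hfg hs

/-- If `∏ |y - a i|² = M ^ d * ∏ |x - a i|²` then `|y - t|² = M * |x - t|²` for some real `t`
between two of the `a i`. -/
lemma exists_normSq_sub_eq_of_prod_eq {d : ℕ} (hd : 1 ≤ d) (a : Fin d → ℝ) (x y : ℂ) {M : ℝ}
    (hM : 0 ≤ M)
    (h : ∏ i, Complex.normSq (y - a i) = M ^ d * ∏ i, Complex.normSq (x - a i)) :
    ∃ i j, ∃ t ∈ Set.uIcc (a i) (a j),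
      Complex.normSq (y - t) - M * Complex.normSq (x - t) = 0 := by
  have hne : (Finset.univ : Finset (Fin d)).Nonempty := ⟨⟨0, hd⟩, Finset.mem_univ _⟩
  have h' : ∏ i, Complex.normSq (y - a i) = ∏ i, M * Complex.normSq (x - a i) := by
    rw [h, Finset.prod_mul_distrib]; simp
  have hle : ∃ i, Complex.normSq (y - a i) ≤ M * Complex.normSq (x - a i) := by
    by_contra! hlt
    exact (prod_lt_prod_of_nonneg_of_nonempty hne
      (fun i _ => mul_nonneg hM (Complex.normSq_nonneg _)) fun i _ => hlt i).ne' h'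
  have hge : ∃ i, M * Complex.normSq (x - a i) ≤ Complex.normSq (y - a i) := by
    by_contra! hlt
    exact (prod_lt_prod_of_nonneg_of_nonempty hne
      (fun i _ => Complex.normSq_nonneg _) fun i _ => hlt i).ne h'
  obtain ⟨i, hi⟩ := hle
  obtain ⟨j, hj⟩ := hge
  have hc : Continuous fun t : ℝ =>
      Complex.normSq (y - t) - M * Complex.normSq (x - t) := by
    have := Complex.continuous_normSq
    fun_prop
  obtain ⟨t, ht, hqt⟩ := intermediate_value_uIcc (hc.continuousOn (s := Set.uIcc (a i) (a j)))
    (Set.mem_uIcc.2 (Or.inl ⟨sub_nonpos.2 hi, sub_nonneg.2 hj⟩))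
  exact ⟨i, j, t, ht, hqt⟩

/-- Two points whose distances to three distinct real points are in a constant ratio are equal
or complex conjugate. -/
lemma eq_or_eq_conj_of_normSq_sub_eq {x y : ℂ} {M t₁ t₂ t₃ : ℝ} (h₁₂ : t₁ < t₂) (h₂₃ : t₂ < t₃)
    (h₁ : Complex.normSq (y - t₁) - M * Complex.normSq (x - t₁) = 0)
    (h₂ : Complex.normSq (y - t₂) - M * Complex.normSq (x - t₂) = 0)
    (h₃ : Complex.normSq (y - t₃) - M * Complex.normSq (x - t₃) = 0) :
    y = x ∨ y = (starRingEnd ℂ) x := by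
  simp only [Complex.normSq_apply, Complex.sub_re, Complex.sub_im, Complex.ofReal_re,
    Complex.ofReal_im, sub_zero] at h₁ h₂ h₃
  have e₁ : (1 - M) * (t₁ + t₂) - 2 * (y.re - M * x.re) = 0 :=
    mul_left_cancel₀ (sub_ne_zero.2 h₁₂.ne') (by linear_combination h₂ - h₁)
  have e₂ : (1 - M) * (t₂ + t₃) - 2 * (y.re - M * x.re) = 0 :=
    mul_left_cancel₀ (sub_ne_zero.2 h₂₃.ne') (by linear_combination h₃ - h₂)
  have hM : 1 - M = 0 :=
    mul_left_cancel₀ (sub_ne_zero.2 (h₁₂.trans h₂₃).ne') (by linear_combination e₂ - e₁)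
  obtain rfl : M = 1 := by linarith
  have hre : y.re = x.re := by linarith
  rw [hre] at h₁
  have him : y.im * y.im = x.im * x.im := by linarith
  rcases mul_self_eq_mul_self_iff.1 him with him | him
  · exact Or.inl (Complex.ext hre him)
  · exact Or.inr (Complex.ext (by simpa using hre) (by simpa using him))

/-- Products over two families of real numbers without common element have no common root. -/
lemma not_prod_sub_eq_zero_and {d : ℕ} {a b : Fin d → ℝ} (hab : ∀ i j, a i < b j) (z : ℂ) :
    ¬ (∏ i, (z - (a i : ℂ)) = 0 ∧ ∏ i, (z - (b i : ℂ)) = 0) := by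
  rintro ⟨ha, hb⟩
  obtain ⟨i, -, hi⟩ := Finset.prod_eq_zero_iff.1 ha
  obtain ⟨j, -, hj⟩ := Finset.prod_eq_zero_iff.1 hb
  refine (hab i j).ne (Complex.ofReal_injective ?_)
  rw [← sub_eq_zero.1 hi, ← sub_eq_zero.1 hj]


/-- Fix `d ≥ 1` and real numbers `a i < b j < c l` (three separated
blocks). Let `F, G, H` be the corresponding block polynomials, viewed as functions
`ℂ → ℂ`. If `x ≠ y` and the vectors `(F x, G x, H x)` and `(F y, G y, H y)` in `ℂ³`
are `ℂ`-linearly dependent, then `y = conj x`; in particular `x` is not real. -/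
theorem rational_harnack_double_points_are_solitary
    (d : ℕ) (hd : 1 ≤ d) (a b c : Fin d → ℝ)
    (hab : ∀ i j, a i < b j) (hbc : ∀ j l, b j < c l)
    (F G H : ℂ → ℂ)
    (hF : ∀ x, F x = ∏ i, (x - (a i : ℂ)))
    (hG : ∀ x, G x = ∏ i, (x - (b i : ℂ)))
    (hH : ∀ x, H x = ∏ i, (x - (c i : ℂ)))
    (x y : ℂ) (hxy : x ≠ y)
    (hdep : ¬ LinearIndependent ℂ ![![F x, G x, H x], ![F y, G y, H y]]) :
    y = (starRingEnd ℂ) x ∧ x ∉ Set.range ((↑) : ℝ → ℂ) := by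
  obtain ⟨s, t, hst0, hst1, hst2, hne⟩ : ∃ s t : ℂ, s * F x + t * F y = 0 ∧
      s * G x + t * G y = 0 ∧ s * H x + t * H y = 0 ∧ (s = 0 → ¬ t = 0) := by
    simpa [LinearIndependent.pair_iff] using hdep
  have ht : t ≠ 0 := by
    rintro rfl
    have hs : s ≠ 0 := fun h => hne h rfl
    apply not_prod_sub_eq_zero_and hab x
    rw [← hF, ← hG]
    simpa [hs] using And.intro hst0 hst1
  obtain ⟨M, hM, hMd⟩ : ∃ M : ℝ, 0 ≤ M ∧ M ^ d = Complex.normSq (-s / t) :=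
    ⟨Complex.normSq (-s / t) ^ (d⁻¹ : ℝ), Real.rpow_nonneg (Complex.normSq_nonneg _) _,
      Real.rpow_inv_natCast_pow (Complex.normSq_nonneg _) (by lia)⟩
  have key : ∀ (e : Fin d → ℝ) (P : ℂ → ℂ), (∀ z, P z = ∏ i, (z - (e i : ℂ))) →
      s * P x + t * P y = 0 → ∃ i j, ∃ r ∈ Set.uIcc (e i) (e j),
        Complex.normSq (y - r) - M * Complex.normSq (x - r) = 0 := by
    intro e P hP h
    apply exists_normSq_sub_eq_of_prod_eq hd e x y hM
    have hy : P y = -s / t * P x := by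
      field_simp
      linear_combination h
    rw [← map_prod, ← map_prod, ← hP, ← hP, hMd, ← map_mul, hy]
  obtain ⟨i₁, j₁, r₁, hr₁, h₁⟩ := key a F hF hst0
  obtain ⟨i₂, j₂, r₂, hr₂, h₂⟩ := key b G hG hst1
  obtain ⟨i₃, j₃, r₃, hr₃, h₃⟩ := key c H hH hst2
  have h₁₂ : r₁ < r₂ := hr₁.2.trans_lt <| lt_of_lt_of_le
    (max_lt (lt_min (hab _ _) (hab _ _)) (lt_min (hab _ _) (hab _ _))) hr₂.1
  have h₂₃ : r₂ < r₃ := hr₂.2.trans_lt <| lt_of_lt_of_le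
    (max_lt (lt_min (hbc _ _) (hbc _ _)) (lt_min (hbc _ _) (hbc _ _))) hr₃.1
  have hy := (eq_or_eq_conj_of_normSq_sub_eq h₁₂ h₂₃ h₁ h₂ h₃).resolve_left hxy.symm
  refine ⟨hy, ?_⟩
  rintro ⟨r, rfl⟩
  exact hxy (by rw [hy, Complex.conj_ofReal])
end

section
/- Let d ≥ 1 be an integer and let a_1,…,a_d, b_1,…,b_d, c_1,…,c_d be real numbers with a_i < b_j < c_l for all indices, and F, G, H the corresponding block polynomials. Then the parametrization is an immersion: for every x ∈ ℂ, at least one of the three Wronskians F(x)G'(x) − F'(x)G(x), F(x)H'(x) − F'(x)H(x), G(x)H'(x) − G'(x)H(x) is nonzero; equivalently, the 2×3 matrix with rows (F(x), G(x), H(x)) and (F'(x), G'(x), H'(x)) has rank 2. -/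
/-- Logarithmic derivative of a product of linear factors, away from its roots. -/
theorem deriv_prod_sub_eq_mul_sum_inv {d : ℕ} (a : Fin d → ℝ) (F : ℂ → ℂ)
    (hF : ∀ x, F x = ∏ i, (x - (a i : ℂ))) (x : ℂ) (hx : ∀ i, x - (a i : ℂ) ≠ 0) :
    deriv F x = F x * ∑ i, (x - (a i : ℂ))⁻¹ := by
  have hFx : F x ≠ 0 := by
    rw [hF]
    exact Finset.prod_ne_zero_iff.mpr fun i _ => hx i
  have h := logDeriv_prod (s := Finset.univ) (f := fun i (y : ℂ) => y - (a i : ℂ)) (x := x)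
    (fun i _ => hx i) (fun i _ => by fun_prop)
  have hF' : F = fun y => ∏ i, (y - (a i : ℂ)) := funext hF
  have h' : logDeriv F x = ∑ i, (x - (a i : ℂ))⁻¹ := by
    rw [hF']
    simpa [logDeriv_apply] using h
  rw [← h', logDeriv_apply]
  field_simp

/-- If a real-linear functional separates the points `1 / (x - a i)` from the points
`1 / (x - b j)`, then the Wronskian of the two products does not vanish at `x`. -/
theorem wronskian_ne_zero_of_separated {d : ℕ} (hd : 1 ≤ d) (a b : Fin d → ℝ) (F G : ℂ → ℂ)
    (hF : ∀ x, F x = ∏ i, (x - (a i : ℂ))) (hG : ∀ x, G x = ∏ i, (x - (b i : ℂ)))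
    (x : ℂ) (ha : ∀ i, x - (a i : ℂ) ≠ 0) (hb : ∀ i, x - (b i : ℂ) ≠ 0)
    (φ : ℂ →ₗ[ℝ] ℝ) (h : ∀ i, φ (x - (a i : ℂ))⁻¹ < φ (x - (b i : ℂ))⁻¹) :
    F x * deriv G x - deriv F x * G x ≠ 0 := by
  have hFx : F x ≠ 0 := by
    rw [hF]
    exact Finset.prod_ne_zero_iff.mpr fun i _ => ha i
  have hGx : G x ≠ 0 := by
    rw [hG]
    exact Finset.prod_ne_zero_iff.mpr fun i _ => hb i
  rw [deriv_prod_sub_eq_mul_sum_inv a F hF x ha, deriv_prod_sub_eq_mul_sum_inv b G hG x hb]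
  intro h0
  have hs : ∑ i, (x - (a i : ℂ))⁻¹ = ∑ i, (x - (b i : ℂ))⁻¹ := by
    refine mul_left_cancel₀ (mul_ne_zero hFx hGx) ?_
    linear_combination -h0
  have hlt : ∑ i, φ (x - (a i : ℂ))⁻¹ < ∑ i, φ (x - (b i : ℂ))⁻¹ :=
    Finset.sum_lt_sum_of_nonempty ⟨⟨0, hd⟩, Finset.mem_univ _⟩ fun i _ => h i
  rw [← map_sum, ← map_sum, hs] at hlt
  exact lt_irrefl _ hlt

/-- At a real point, the Wronskian is nonzero as soon as the reciprocals are separated. -/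
theorem wronskian_ofReal_ne_zero {d : ℕ} (hd : 1 ≤ d) (a b : Fin d → ℝ) (F G : ℂ → ℂ)
    (hF : ∀ x, F x = ∏ i, (x - (a i : ℂ))) (hG : ∀ x, G x = ∏ i, (x - (b i : ℂ)))
    (u : ℝ) (ha : ∀ i, u - a i ≠ 0) (hb : ∀ i, u - b i ≠ 0)
    (h : (∀ i, (u - a i)⁻¹ < (u - b i)⁻¹) ∨ ∀ i, (u - b i)⁻¹ < (u - a i)⁻¹) :
    F u * deriv G u - deriv F u * G u ≠ 0 := by
  have key (t : ℝ) : ((u : ℂ) - (t : ℂ))⁻¹.re = (u - t)⁻¹ := by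
    rw [← Complex.ofReal_sub, ← Complex.ofReal_inv, Complex.ofReal_re]
  have ha' (i) : (u : ℂ) - (a i : ℂ) ≠ 0 := by exact_mod_cast ha i
  have hb' (i) : (u : ℂ) - (b i : ℂ) ≠ 0 := by exact_mod_cast hb i
  rcases h with h | h
  · refine wronskian_ne_zero_of_separated hd a b F G hF hG u ha' hb' Complex.reLm fun i => ?_
    simpa only [Complex.reLm_coe, key] using h i
  · refine wronskian_ne_zero_of_separated hd a b F G hF hG u ha' hb' (-Complex.reLm) fun i => ?_
    simpa only [LinearMap.neg_apply, Complex.reLm_coe, key, neg_lt_neg_iff] using h i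

/-- Two separated blocks of real roots have nonvanishing Wronskian off the real line. -/
theorem wronskian_ne_zero_of_im_ne_zero {d : ℕ} (hd : 1 ≤ d) (a b : Fin d → ℝ)
    (hab : ∀ i j, a i < b j) (F G : ℂ → ℂ)
    (hF : ∀ x, F x = ∏ i, (x - (a i : ℂ))) (hG : ∀ x, G x = ∏ i, (x - (b i : ℂ)))
    (x : ℂ) (hx : x.im ≠ 0) :
    F x * deriv G x - deriv F x * G x ≠ 0 := by
  have hne (t : ℝ) : x - (t : ℂ) ≠ 0 := fun h => hx (by simpa using congrArg Complex.im h)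
  have : Nonempty (Fin d) := ⟨⟨0, hd⟩⟩
  obtain ⟨k, hk⟩ := Finite.exists_max a
  have key (t : ℝ) : (-Complex.reLm - ((x.re - a k) / x.im) • Complex.imLm) (x - (t : ℂ))⁻¹
      = (t - a k) / Complex.normSq (x - (t : ℂ)) := by
    have h0 : Complex.normSq (x - (t : ℂ)) ≠ 0 := by simpa using hne t
    simp only [LinearMap.sub_apply, LinearMap.neg_apply, LinearMap.smul_apply, Complex.reLm_coe,
      Complex.imLm_coe, Complex.inv_re, Complex.inv_im, Complex.sub_re, Complex.sub_im,
      Complex.ofReal_re, Complex.ofReal_im, smul_eq_mul]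
    field_simp
    ring
  refine wronskian_ne_zero_of_separated hd a b F G hF hG x (fun i => hne _) (fun i => hne _)
    (-Complex.reLm - ((x.re - a k) / x.im) • Complex.imLm) fun i => ?_
  rw [key, key]
  exact (div_nonpos_of_nonpos_of_nonneg (sub_nonpos.mpr (hk i)) (Complex.normSq_nonneg _)).trans_lt
    (div_pos (sub_pos.mpr (hab k i)) (Complex.normSq_pos.mpr (hne _)))


/-- With the block polynomials `F, G, H` of a rational simple
Harnack parametrization, for every `x ∈ ℂ` at least one of the three Wronskians
`F G' − F' G`, `F H' − F' H`, `G H' − G' H` does not vanish at `x`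
(i.e. the parametrization is an immersion). -/
theorem rational_harnack_is_immersion
    (d : ℕ) (hd : 1 ≤ d) (a b c : Fin d → ℝ)
    (hab : ∀ i j, a i < b j) (hbc : ∀ j l, b j < c l)
    (F G H : ℂ → ℂ)
    (hF : ∀ x, F x = ∏ i, (x - (a i : ℂ)))
    (hG : ∀ x, G x = ∏ i, (x - (b i : ℂ)))
    (hH : ∀ x, H x = ∏ i, (x - (c i : ℂ)))
    (x : ℂ) :
    F x * deriv G x - deriv F x * G x ≠ 0 ∨
    F x * deriv H x - deriv F x * H x ≠ 0 ∨
    G x * deriv H x - deriv G x * H x ≠ 0 := by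
  by_cases hx : x.im = 0
  · obtain ⟨u, rfl⟩ : ∃ u : ℝ, x = u := ⟨x.re, Complex.ext (by simp) (by simpa using hx)⟩
    by_cases h1 : ∀ j, u < b j
    · have h2 (l) : u < c l := (h1 ⟨0, hd⟩).trans (hbc _ l)
      refine Or.inr (Or.inr (wronskian_ofReal_ne_zero hd b c G H hG hH u
        (fun i => (sub_neg.mpr (h1 i)).ne) (fun i => (sub_neg.mpr (h2 i)).ne) (Or.inl fun i => ?_)))
      rw [inv_lt_inv_of_neg (sub_neg.mpr (h1 i)) (sub_neg.mpr (h2 i))]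
      linarith [hbc i i]
    by_cases h2 : ∀ j, b j < u
    · have h3 (l) : a l < u := (hab l ⟨0, hd⟩).trans (h2 _)
      refine Or.inl (wronskian_ofReal_ne_zero hd a b F G hF hG u
        (fun i => (sub_pos.mpr (h3 i)).ne') (fun i => (sub_pos.mpr (h2 i)).ne')
        (Or.inl fun i => ?_))
      rw [inv_lt_inv₀ (sub_pos.mpr (h3 i)) (sub_pos.mpr (h2 i))]
      linarith [hab i i]
    push Not at h1 h2
    obtain ⟨j, hj⟩ := h1
    obtain ⟨k, hk⟩ := h2
    have ha (i) : 0 < u - a i := sub_pos.mpr ((hab i j).trans_le hj)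
    have hc (i) : u - c i < 0 := sub_neg.mpr (hk.trans_lt (hbc k i))
    exact Or.inr (Or.inl (wronskian_ofReal_ne_zero hd a c F H hF hH u
      (fun i => (ha i).ne') (fun i => (hc i).ne)
      (Or.inr fun i => (inv_lt_zero.mpr (hc i)).trans (inv_pos.mpr (ha i)))))
  · exact Or.inl (wronskian_ne_zero_of_im_ne_zero hd a b hab F G hF hG x hx)
end

section
/- Let d ≥ 1 be an integer and let a_1,…,a_d, b_1,…,b_d, c_1,…,c_d be real numbers with a_i < b_j < c_l for all indices, and F, G, H the corresponding block polynomials. Then the set {x ∈ ℂ : x ∉ ℝ and the vectors (F(x), G(x), H(x)) and (F(conj x), G(conj x), H(conj x)) are ℂ-linearly dependent} has exactly (d−1)(d−2) elements. (These parameters come in (d−1)(d−2)/2 conjugate pairs, corresponding to the (d−1)(d−2)/2 solitary nodes of the rational simple Harnack curve of degree d.) -/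
open Filter Topology Set

/-- A proper local homeomorphism from a nonempty connected Hausdorff space to a simply connected,
locally path connected Hausdorff space is bijective. -/
theorem IsLocalHomeomorph.bijective_of_isProperMap {E X : Type*} [TopologicalSpace E]
    [TopologicalSpace X] [T2Space E] [T2Space X] [ConnectedSpace E] [SimplyConnectedSpace X]
    [LocallyPathConnectedSpace X] {f : E → X} (hf : IsLocalHomeomorph f) (hp : IsProperMap f) :
    Function.Bijective f := by
  have hfin : ∀ x, (f ⁻¹' {x}).Finite := fun x ↦
    (hp.isCompact_preimage isCompact_singleton).finite <|
      IsDiscrete.of_openPartialHomeomorph f subset_rfl fun e _ ↦ by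
        obtain ⟨φ, hφ, h⟩ := hf e
        exact ⟨φ, hφ, h.symm⟩
  have cov : IsCoveringMap f :=
    isCoveringMap_iff_isCoveringMapOn_univ.2 <|
      hp.isClosedMap.isCoveringMapOn_of_isLocalHomeomorphOn (fun x _ ↦ hfin x)
        (by simpa using isLocalHomeomorph_iff_isLocalHomeomorphOn_univ.1 hf)
  have key : ∀ e : E, ∃ s : C(X, E), s (f e) = e ∧ f ∘ s = id := fun e ↦ by
    obtain ⟨s, hs, -⟩ := cov.existsUnique_continuousMap_lifts (ContinuousMap.id X) (f e) e rfl
    exact ⟨s, hs.1, by simpa using hs.2⟩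
  constructor
  · intro e e' hee
    obtain ⟨s, hs, hfs⟩ := key e
    have : s ∘ f = id := cov.eq_of_comp_eq (s.continuous.comp cov.continuous) continuous_id
      (by rw [← Function.comp_assoc, hfs]; rfl) e hs
    have h' : s (f e') = e' := congr_fun this e'
    rw [← hs, hee, h']
  · intro x
    obtain ⟨e⟩ : Nonempty E := inferInstance
    obtain ⟨s, -, hfs⟩ := key e
    exact ⟨s x, congr_fun hfs x⟩

/-- A global inverse function theorem: a map with everywhere invertible strict derivative which is
proper from a connected open set to a convex open set is a bijection between them. -/
theorem bijOn_of_hasStrictFDerivAt_equiv {V W : Type*} [NormedAddCommGroup V] [NormedSpace ℝ V]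
    [CompleteSpace V] [NormedAddCommGroup W] [NormedSpace ℝ W] [FiniteDimensional ℝ W]
    {f : V → W} {U : Set V} {X : Set W} (hU : IsOpen U) (hUc : IsConnected U) (hX : IsOpen X)
    (hXc : Convex ℝ X) (hm : MapsTo f U X)
    (hd : ∀ z ∈ U, ∃ f' : V ≃L[ℝ] W, HasStrictFDerivAt f (f' : V →L[ℝ] W) z)
    (hp : ∀ K ⊆ X, IsCompact K → ∃ T ⊆ U, IsCompact T ∧ U ∩ f ⁻¹' K ⊆ T) :
    BijOn f U X := by
  have hloc : IsLocalHomeomorphOn f U := IsLocalHomeomorphOn.mk f U fun z hz ↦ by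
    obtain ⟨f', hf'⟩ := hd z hz
    exact ⟨hf'.toOpenPartialHomeomorph f, hf'.mem_toOpenPartialHomeomorph_source,
      by simp [EqOn]⟩
  let g : U → X := hm.restrict f U X
  have hgc : Continuous g := Continuous.subtype_mk (continuousOn_iff_continuous_domRestrict.1
    fun z hz ↦ (hd z hz).choose_spec.continuousAt.continuousWithinAt) _
  have hgl : IsLocalHomeomorph g := by
    refine IsLocalHomeomorph.of_comp (g := ((↑) : X → W)) ?_
      hX.isOpenEmbedding_subtypeVal.isLocalHomeomorph hgc
    have h1 := hloc.comp (isLocalHomeomorph_iff_isLocalHomeomorphOn_univ.1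
      hU.isOpenEmbedding_subtypeVal.isLocalHomeomorph) (fun z _ ↦ z.2)
    exact isLocalHomeomorph_iff_isLocalHomeomorphOn_univ.2 h1
  have : ProperSpace W := FiniteDimensional.proper ℝ W
  have : LocallyCompactSpace X := hX.locallyCompactSpace
  have hgp : IsProperMap g := by
    refine isProperMap_iff_isCompact_preimage.2 ⟨hgc, fun K hK ↦ ?_⟩
    obtain ⟨T, hTU, hT, hKT⟩ := hp ((↑) '' K) (by simp) (hK.image continuous_subtype_val)
    refine (IsInducing.subtypeVal.isCompact_preimage' hT (by simpa)).of_isClosed_subset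
      (hK.isClosed.preimage hgc) fun z hz ↦ hKT ⟨z.2, ⟨g z, hz, rfl⟩⟩
  have : ConnectedSpace U := isConnected_iff_connectedSpace.1 hUc
  have : ContractibleSpace X := hXc.contractibleSpace (hUc.nonempty.image f |>.mono hm.image_subset)
  have : LocallyPathConnectedSpace X := hX.locallyPathConnectedSpace
  have hb := hgl.bijective_of_isProperMap hgp
  refine ⟨hm, fun z hz w hw h ↦ ?_, fun x hx ↦ ?_⟩
  · exact congr_arg Subtype.val (@hb.1 ⟨z, hz⟩ ⟨w, hw⟩ (Subtype.ext h))
  · obtain ⟨z, hz⟩ := hb.2 ⟨x, hx⟩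
    exact ⟨z, z.2, congr_arg Subtype.val hz⟩

open Complex ComplexConjugate in
theorem Complex.arg_div_eq_sub_of_im_pos {z w : ℂ} (hz : 0 < z.im) (hw : 0 < w.im) :
    (z / w).arg = z.arg - w.arg := by
  have hz0 : z ≠ 0 := by rintro rfl; simp at hz
  have hw0 : w ≠ 0 := by rintro rfl; simp at hw
  have h1 := arg_nonneg_iff.2 hz.le
  have h2 := arg_nonneg_iff.2 hw.le
  have h3 := arg_lt_pi_iff.2 (Or.inr hz.ne')
  have h4 := arg_lt_pi_iff.2 (Or.inr hw.ne')
  have h5 : (w⁻¹).arg = -w.arg := by rw [arg_inv, if_neg h4.ne]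
  rw [div_eq_mul_inv, (arg_mul_eq_add_arg_iff hz0 (inv_ne_zero hw0)).2, h5, sub_eq_add_neg]
  rw [h5]
  constructor <;> linarith

theorem Complex.arg_sub_ofReal_lt {z : ℂ} (hz : 0 < z.im) {s t : ℝ} (h : s < t) :
    (z - s).arg < (z - t).arg := by
  have hs : 0 < (z - s).im := by simpa
  have ht : 0 < (z - t).im := by simpa
  have h1 : 0 < ((z - t) / (z - s)).im := by
    have h2 : 0 < normSq (z - s) := normSq_pos.2 fun h0 ↦ by simp [h0] at hs
    rw [div_im, ← sub_div]
    apply div_pos _ h2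
    simp
    nlinarith
  rw [← sub_pos, ← arg_div_eq_sub_of_im_pos ht hs]
  exact lt_of_le_of_ne (arg_nonneg_iff.2 h1.le) fun h0 ↦ h1.ne' (arg_eq_zero_iff.1 h0.symm).2

theorem Complex.arg_sub_ofReal_pos {z : ℂ} (hz : 0 < z.im) (t : ℝ) : 0 < (z - t).arg :=
  lt_of_le_of_ne (arg_nonneg_iff.2 (by simpa using hz.le)) fun h0 ↦
    hz.ne' (by simpa using (arg_eq_zero_iff.1 h0.symm).2)

theorem Complex.arg_sub_ofReal_lt_pi {z : ℂ} (hz : 0 < z.im) (t : ℝ) : (z - t).arg < Real.pi :=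
  arg_lt_pi_iff.2 (Or.inr (by simpa using hz.ne'))

theorem Complex.tendsto_arg_sub_ofReal_of_lt {r t : ℝ} (h : t < r) :
    Tendsto (fun z : ℂ ↦ (z - t).arg) (𝓝[{z | 0 < z.im}] (r : ℂ)) (𝓝 0) := by
  have h1 : ContinuousAt (fun z : ℂ ↦ (z - t).arg) (r : ℂ) :=
    (continuousAt_arg (by left; simpa)).comp (f := fun z : ℂ ↦ z - t) (by fun_prop)
  have h2 : ((r : ℂ) - t).arg = 0 := by
    rw [← ofReal_sub]; exact arg_ofReal_of_nonneg (by linarith)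
  have h3 := h1.tendsto.mono_left (nhdsWithin_le_nhds (s := {z | 0 < z.im}))
  rwa [h2] at h3

theorem Complex.tendsto_arg_sub_ofReal_of_gt {r t : ℝ} (h : r < t) :
    Tendsto (fun z : ℂ ↦ (z - t).arg) (𝓝[{z | 0 < z.im}] (r : ℂ)) (𝓝 Real.pi) := by
  refine (tendsto_arg_nhdsWithin_im_nonneg_of_re_neg_of_im_zero (z := r - t) (by simpa)
    (by simp)).comp (tendsto_nhdsWithin_iff.2 ⟨?_, ?_⟩)
  · exact (Continuous.tendsto (by fun_prop) _).mono_left nhdsWithin_le_nhds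
  · filter_upwards [self_mem_nhdsWithin] with z hz
    have hz' : 0 < z.im := hz
    simpa using hz'.le

theorem Complex.tendsto_arg_sub_sub_arg_sub_cocompact (s t : ℝ) :
    Tendsto (fun z : ℂ ↦ (z - t).arg - (z - s).arg) (cocompact ℂ ⊓ 𝓟 {z | 0 < z.im}) (𝓝 0) := by
  have h1 : Tendsto (fun z : ℂ ↦ (z - t) / (z - s)) (cocompact ℂ) (𝓝 1) := by
    have h2 : Tendsto (fun z : ℂ ↦ z - s) (cocompact ℂ) (cocompact ℂ) :=
      (Homeomorph.subRight (s : ℂ)).isClosedEmbedding.tendsto_cocompact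
    have h3 : Tendsto (fun z : ℂ ↦ 1 + (s - t) * (z - s)⁻¹) (cocompact ℂ) (𝓝 1) := by
      simpa using ((tendsto_inv₀_cobounded.comp
        (by simpa [Metric.cobounded_eq_cocompact] using h2)).const_mul ((s : ℂ) - t)).const_add 1
    refine h3.congr' ?_
    filter_upwards [(isCompact_singleton (x := (s : ℂ))).compl_mem_cocompact] with z hz
    have : z - s ≠ 0 := sub_ne_zero.2 hz
    field_simp
    ring
  have h4 := ((continuousAt_arg one_mem_slitPlane).tendsto.comp h1).mono_left
    (inf_le_left (b := 𝓟 {z : ℂ | 0 < z.im}))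
  rw [arg_one] at h4
  refine h4.congr' ?_
  filter_upwards [mem_inf_of_right (mem_principal_self _)] with z hz
  exact arg_div_eq_sub_of_im_pos (by simpa using hz) (by simpa using hz)

/-- The sum of the arguments of `z - a i`. -/
noncomputable def argSum {d : ℕ} (a : Fin d → ℝ) (z : ℂ) : ℝ := ∑ i, (z - a i).arg

section argSum

variable {d : ℕ} {a b c : Fin d → ℝ}

theorem argSum_lt_argSum (hd : 1 ≤ d) (hab : ∀ i j, a i < b j) {z : ℂ} (hz : 0 < z.im) :
    argSum a z < argSum b z :=
  Finset.sum_lt_sum_of_nonempty ⟨⟨0, hd⟩, Finset.mem_univ _⟩ fun i _ ↦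
    Complex.arg_sub_ofReal_lt hz (hab i i)

theorem argSum_pos (hd : 1 ≤ d) (a : Fin d → ℝ) {z : ℂ} (hz : 0 < z.im) : 0 < argSum a z :=
  Finset.sum_pos (fun i _ ↦ Complex.arg_sub_ofReal_pos hz (a i)) ⟨⟨0, hd⟩, Finset.mem_univ _⟩

theorem argSum_lt_mul_pi (hd : 1 ≤ d) (a : Fin d → ℝ) {z : ℂ} (hz : 0 < z.im) :
    argSum a z < d * Real.pi := by
  have h : argSum a z < ∑ _i : Fin d, Real.pi :=
    Finset.sum_lt_sum_of_nonempty ⟨⟨0, hd⟩, Finset.mem_univ _⟩ fun i _ ↦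
      Complex.arg_sub_ofReal_lt_pi hz (a i)
  simpa using h

theorem tendsto_argSum_of_lt {r : ℝ} (h : ∀ i, a i < r) :
    Tendsto (argSum a) (𝓝[{z | 0 < z.im}] (r : ℂ)) (𝓝 0) := by
  unfold argSum
  simpa using tendsto_finsetSum Finset.univ fun i _ ↦ Complex.tendsto_arg_sub_ofReal_of_lt (h i)

theorem tendsto_argSum_of_gt {r : ℝ} (h : ∀ i, r < a i) :
    Tendsto (argSum a) (𝓝[{z | 0 < z.im}] (r : ℂ)) (𝓝 (d * Real.pi)) := by
  unfold argSum
  simpa using tendsto_finsetSum Finset.univ fun i _ ↦ Complex.tendsto_arg_sub_ofReal_of_gt (h i)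

theorem tendsto_argSum_sub_argSum_cocompact (a b : Fin d → ℝ) :
    Tendsto (fun z ↦ argSum b z - argSum a z) (cocompact ℂ ⊓ 𝓟 {z | 0 < z.im}) (𝓝 0) := by
  simpa [argSum] using tendsto_finsetSum Finset.univ
    fun i _ ↦ Complex.tendsto_arg_sub_sub_arg_sub_cocompact (a i) (b i)

theorem hasStrictFDerivAt_argSum (a : Fin d → ℝ) {z : ℂ} (hz : 0 < z.im) :
    HasStrictFDerivAt (argSum a)
      (Complex.imCLM ∘L ((∑ i, (z - a i)⁻¹) • (1 : ℂ →L[ℝ] ℂ))) z := by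
  have h1 : HasStrictDerivAt (fun w : ℂ ↦ ∑ i, Complex.log (w - a i)) (∑ i, (z - a i)⁻¹) z := by
    refine HasStrictDerivAt.fun_sum fun i _ ↦ ?_
    have h2 : z - a i ∈ Complex.slitPlane := Or.inr (by simpa using hz.ne')
    simpa [Function.comp_def] using (Complex.hasStrictDerivAt_log h2).comp z
      ((hasStrictDerivAt_id z).sub_const (a i : ℂ))
  have h3 := Complex.imCLM.hasStrictFDerivAt.comp z h1.complexToReal_fderiv
  convert! h3 using 1
  ext w
  simp [argSum, Complex.log_im]

theorem im_sum_inv_mul_conj_pos (hd : 1 ≤ d) (hab : ∀ i j, a i < b j) (hbc : ∀ i j, b i < c j)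
    {z : ℂ} (hz : 0 < z.im) :
    0 < ((∑ i, (z - b i)⁻¹ - ∑ i, (z - a i)⁻¹) *
      (starRingEnd ℂ) (∑ i, (z - c i)⁻¹ - ∑ i, (z - b i)⁻¹)).im := by
  have triple : ∀ p q r : ℝ, p < q → q < r →
      0 < ((z - q)⁻¹ * (starRingEnd ℂ) (z - r)⁻¹ + (z - p)⁻¹ * (starRingEnd ℂ) (z - q)⁻¹
        + (z - r)⁻¹ * (starRingEnd ℂ) (z - p)⁻¹).im := by
    intro p q r hpq hqr
    have hpos : ∀ t : ℝ, 0 < (z.re - t) ^ 2 + z.im ^ 2 := fun t ↦ by positivity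
    have hP := hpos p
    have hQ := hpos q
    have hR := hpos r
    have : ((z - q)⁻¹ * (starRingEnd ℂ) (z - r)⁻¹ + (z - p)⁻¹ * (starRingEnd ℂ) (z - q)⁻¹
        + (z - r)⁻¹ * (starRingEnd ℂ) (z - p)⁻¹).im =
        z.im * (q - p) * (r - q) * (r - p) / (((z.re - p) ^ 2 + z.im ^ 2) *
          ((z.re - q) ^ 2 + z.im ^ 2) * ((z.re - r) ^ 2 + z.im ^ 2)) := by
      simp only [Complex.add_im, Complex.mul_im, Complex.inv_re, Complex.inv_im, Complex.conj_re,
        Complex.conj_im, Complex.sub_re, Complex.sub_im, Complex.ofReal_re, Complex.ofReal_im,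
        Complex.normSq_apply, sub_zero, ← sq]
      field_simp
      ring
    rw [this]
    have := sub_pos.2 hpq
    have := sub_pos.2 hqr
    have := sub_pos.2 (hpq.trans hqr)
    positivity
  have hne : (Finset.univ : Finset (Fin d)).Nonempty := ⟨⟨0, hd⟩, Finset.mem_univ _⟩
  have hsum : 0 < ∑ i, ∑ j, ∑ k, ((z - b j)⁻¹ * (starRingEnd ℂ) (z - c k)⁻¹
      + (z - a i)⁻¹ * (starRingEnd ℂ) (z - b j)⁻¹
      + (z - c k)⁻¹ * (starRingEnd ℂ) (z - a i)⁻¹).im :=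
    Finset.sum_pos (fun i _ ↦ Finset.sum_pos (fun j _ ↦ Finset.sum_pos (fun k _ ↦
      triple _ _ _ (hab i j) (hbc j k)) hne) hne) hne
  simp only [← Complex.im_sum] at hsum
  set A := ∑ i, (z - a i)⁻¹ with hA
  set B := ∑ i, (z - b i)⁻¹ with hB
  set C := ∑ i, (z - c i)⁻¹ with hC
  have heq : ∑ i, ∑ j, ∑ k, ((z - b j)⁻¹ * (starRingEnd ℂ) (z - c k)⁻¹
      + (z - a i)⁻¹ * (starRingEnd ℂ) (z - b j)⁻¹
      + (z - c k)⁻¹ * (starRingEnd ℂ) (z - a i)⁻¹) =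
      d * (B * (starRingEnd ℂ) C + A * (starRingEnd ℂ) B + C * (starRingEnd ℂ) A) := by
    simp only [hA, hB, hC, map_sum, Finset.sum_add_distrib, Finset.sum_const, Finset.card_univ,
      Fintype.card_fin, ← Finset.mul_sum, ← Finset.sum_mul, nsmul_eq_mul]
    ring
  rw [heq, ← Complex.ofReal_natCast, Complex.im_ofReal_mul] at hsum
  have hd' : (0 : ℝ) < d := by exact_mod_cast hd
  have h := pos_of_mul_pos_right hsum hd'.le
  simp only [Complex.add_im, Complex.mul_im, Complex.conj_re, Complex.conj_im, Complex.sub_im,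
    Complex.sub_re] at h ⊢
  linarith

end argSum

/-- Two complex numbers which are not real multiples of each other define a linear isomorphism
from `ℂ` to `ℝ × ℝ`. -/
theorem Complex.exists_equiv_im_mul {p q : ℂ} (h : (p * (starRingEnd ℂ) q).im ≠ 0) :
    ∃ e : ℂ ≃L[ℝ] ℝ × ℝ, (e : ℂ →L[ℝ] ℝ × ℝ) =
      (imCLM ∘L (p • (1 : ℂ →L[ℝ] ℂ))).prod (imCLM ∘L (q • (1 : ℂ →L[ℝ] ℂ))) := by
  set L := (imCLM ∘L (p • (1 : ℂ →L[ℝ] ℂ))).prod (imCLM ∘L (q • (1 : ℂ →L[ℝ] ℂ)))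
  have hinj : Function.Injective (L : ℂ →ₗ[ℝ] ℝ × ℝ) := by
    refine (injective_iff_map_eq_zero _).2 fun w hw ↦ ?_
    have h1 : (p * w).im = 0 := congr_arg Prod.fst hw
    have h2 : (q * w).im = 0 := congr_arg Prod.snd hw
    simp only [mul_im, conj_re, conj_im] at h h1 h2
    have h3 : (p.re * -q.im + p.im * q.re) * w.re = 0 := by linear_combination q.re * h1 - p.re * h2
    have h4 : (p.re * -q.im + p.im * q.re) * w.im = 0 := by linear_combination p.im * h2 - q.im * h1
    exact Complex.ext ((mul_eq_zero.1 h3).resolve_left h) ((mul_eq_zero.1 h4).resolve_left h)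
  exact ⟨(LinearEquiv.ofInjectiveOfFinrankEq (L : ℂ →ₗ[ℝ] ℝ × ℝ) hinj
    (by simp [Complex.finrank_real_complex])).toContinuousLinearEquiv, by ext <;> rfl⟩

/-- The pair of differences of consecutive argument sums of three separated families of `d` real
numbers maps the upper half plane bijectively onto an open triangle. -/
theorem bijOn_argSum_sub {d : ℕ} (hd : 1 ≤ d) {a b c : Fin d → ℝ}
    (hab : ∀ i j, a i < b j) (hbc : ∀ j l, b j < c l) :
    BijOn (fun z ↦ (argSum b z - argSum a z, argSum c z - argSum b z)) {z : ℂ | 0 < z.im}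
      {p : ℝ × ℝ | 0 < p.1 ∧ 0 < p.2 ∧ p.1 + p.2 < d * Real.pi} := by
  set U := {z : ℂ | 0 < z.im} with hUdef
  have hU : IsOpen U := isOpen_lt continuous_const Complex.continuous_im
  refine bijOn_of_hasStrictFDerivAt_equiv hU ?_ ?_ ?_ ?_ ?_ ?_
  · exact ((convex_halfSpace_im_gt 0).isPathConnected ⟨Complex.I, by simp⟩).isConnected
  · exact (isOpen_lt continuous_const continuous_fst).inter
      ((isOpen_lt continuous_const continuous_snd).inter
        (isOpen_lt (continuous_fst.add continuous_snd) continuous_const))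
  · exact ((convex_Ioi 0).linear_preimage (LinearMap.fst ℝ ℝ ℝ)).inter
      (((convex_Ioi 0).linear_preimage (LinearMap.snd ℝ ℝ ℝ)).inter
        ((convex_Iio _).linear_preimage (LinearMap.fst ℝ ℝ ℝ + LinearMap.snd ℝ ℝ ℝ)))
  · intro z hz
    have h1 := argSum_lt_argSum hd hab hz
    have h2 := argSum_lt_argSum hd hbc hz
    have h3 := argSum_pos hd a hz
    have h4 := argSum_lt_mul_pi hd c hz
    refine ⟨?_, ?_, ?_⟩ <;> dsimp only <;> linarith
  · intro z hz
    obtain ⟨e, he⟩ := Complex.exists_equiv_im_mul (im_sum_inv_mul_conj_pos hd hab hbc hz).ne'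
    refine ⟨e, ?_⟩
    rw [he]
    convert! ((hasStrictFDerivAt_argSum b hz).sub (hasStrictFDerivAt_argSum a hz)).prodMk
      ((hasStrictFDerivAt_argSum c hz).sub (hasStrictFDerivAt_argSum b hz)) using 2 <;>
    ext <;> simp [sub_mul]
  · intro K hKX hK
    obtain ⟨ε, hε, hKε⟩ : ∃ ε > 0, ∀ p ∈ K, ε ≤ p.1 ∧ ε ≤ p.2 ∧ p.1 + p.2 ≤ d * Real.pi - ε := by
      obtain rfl | hne := K.eq_empty_or_nonempty
      · exact ⟨1, one_pos, by simp⟩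
      obtain ⟨q, hq, hmin⟩ := hK.exists_isMinOn hne
        (f := fun p : ℝ × ℝ ↦ min p.1 (min p.2 (d * Real.pi - (p.1 + p.2)))) (by fun_prop)
      obtain ⟨h1, h2, h3⟩ := hKX hq
      refine ⟨_, lt_min h1 (lt_min h2 (sub_pos.2 h3)), fun p hp ↦ ?_⟩
      have h4 := hmin hp
      simp only [mem_ofPred_eq, le_min_iff] at h4
      exact ⟨h4.1, h4.2.1, by linarith [h4.2.2]⟩
    set S := U ∩ (fun z ↦ (argSum b z - argSum a z, argSum c z - argSum b z)) ⁻¹' K with hS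
    have hSε : ∀ z ∈ S, ε ≤ argSum b z - argSum a z ∧ ε ≤ argSum c z - argSum b z ∧
        argSum c z - argSum a z ≤ d * Real.pi - ε := fun z hz ↦ by
      obtain ⟨h1, h2, h3⟩ := hKε _ hz.2
      exact ⟨h1, h2, by dsimp only at h3; linarith⟩
    refine ⟨closure S, fun z hz ↦ ?_, ?_, subset_closure⟩
    · have him : 0 ≤ z.im := closure_minimal (t := {z : ℂ | 0 ≤ z.im})
        (fun w hw ↦ le_of_lt (show 0 < w.im from hw.1)) (isClosed_le continuous_const Complex.continuous_im) hz
      refine lt_of_le_of_ne him fun h0 ↦ ?_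
      obtain ⟨r, rfl⟩ : ∃ r : ℝ, (r : ℂ) = z := ⟨z.re, Complex.ext rfl h0⟩
      have := mem_closure_iff_nhdsWithin_neBot.1 hz
      have hle : 𝓝[S] (r : ℂ) ≤ 𝓝[U] (r : ℂ) := nhdsWithin_mono _ inter_subset_left
      have hself : ∀ᶠ w in 𝓝[S] (r : ℂ), w ∈ S := self_mem_nhdsWithin
      by_cases h1 : ∀ j, r < b j
      · have h2 := ((tendsto_argSum_of_gt fun l ↦ (h1 ⟨0, hd⟩).trans (hbc _ l)).sub
          (tendsto_argSum_of_gt h1)).mono_left hle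
        rw [sub_self] at h2
        exact hε.not_ge (ge_of_tendsto h2 (hself.mono fun w hw ↦ (hSε w hw).2.1))
      by_cases h2 : ∀ j, b j < r
      · have h3 := ((tendsto_argSum_of_lt h2).sub
          (tendsto_argSum_of_lt fun l ↦ (hab l ⟨0, hd⟩).trans (h2 _))).mono_left hle
        rw [sub_self] at h3
        exact hε.not_ge (ge_of_tendsto h3 (hself.mono fun w hw ↦ (hSε w hw).1))
      push Not at h1 h2
      obtain ⟨j, hj⟩ := h1
      obtain ⟨l, hl⟩ := h2
      have h3 := ((tendsto_argSum_of_gt fun i ↦ hl.trans_lt (hbc l i)).sub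
        (tendsto_argSum_of_lt fun i ↦ (hab i j).trans_le hj)).mono_left hle
      have h4 := le_of_tendsto h3 (hself.mono fun w hw ↦ (hSε w hw).2.2)
      linarith
    · have h1 := (tendsto_argSum_sub_argSum_cocompact a b).eventually_lt_const hε
      rw [eventually_inf_principal] at h1
      obtain ⟨T, hT, hTS⟩ := mem_cocompact.1 h1
      refine hT.of_isClosed_subset isClosed_closure (closure_minimal (fun z hz ↦ ?_) hT.isClosed)
      by_contra hzT
      exact (hTS hzT hz.1).not_ge (hSε z hz).1

open ComplexConjugate in
theorem im_prod_mul_conj_prod_eq_zero_iff {d : ℕ} (a b : Fin d → ℝ) {z : ℂ} (hz : 0 < z.im) :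
    ((∏ i, (z - b i)) * conj (∏ i, (z - a i))).im = 0 ↔
      ∃ k : ℤ, (k : ℝ) * Real.pi = argSum b z - argSum a z := by
  have polar : ∀ e : Fin d → ℝ, ∃ r : ℝ, r ≠ 0 ∧
      ∏ i, (z - e i) = r * Complex.exp (argSum e z * Complex.I) := fun e ↦ by
    refine ⟨∏ i, ‖z - e i‖, Finset.prod_ne_zero_iff.2 fun i _ ↦ norm_ne_zero_iff.2 fun h ↦ ?_, ?_⟩
    · have := congr_arg Complex.im h
      simp [hz.ne'] at this
    · rw [argSum, Complex.ofReal_sum, Finset.sum_mul, Complex.exp_sum, Complex.ofReal_prod,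
        ← Finset.prod_mul_distrib]
      simp only [Complex.norm_mul_exp_arg_mul_I]
  obtain ⟨r, hr, hA⟩ := polar a
  obtain ⟨s, hs, hB⟩ := polar b
  have h : (∏ i, (z - b i)) * conj (∏ i, (z - a i)) =
      ((s * r : ℝ) : ℂ) * Complex.exp ((argSum b z - argSum a z : ℝ) * Complex.I) := by
    rw [hA, hB, map_mul, Complex.conj_ofReal, ← Complex.exp_conj, map_mul, Complex.conj_I,
      Complex.conj_ofReal, Complex.ofReal_sub, sub_mul, sub_eq_add_neg, Complex.exp_add]
    push_cast
    ring_nf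
  rw [h, Complex.im_ofReal_mul, Complex.exp_ofReal_mul_I_im, mul_eq_zero,
    or_iff_right (mul_ne_zero hs hr), Real.sin_eq_zero_iff]

/-- A vector of `ℂ³` with nonzero middle coordinate is linearly dependent with its conjugate if and
only if the ratios of consecutive coordinates are real. -/
theorem not_linearIndependent_conj_iff {p q r : ℂ} (hq : q ≠ 0) :
    ¬ LinearIndependent ℂ ![![p, q, r],
        ![(starRingEnd ℂ) p, (starRingEnd ℂ) q, (starRingEnd ℂ) r]] ↔
      (q * (starRingEnd ℂ) p).im = 0 ∧ (r * (starRingEnd ℂ) q).im = 0 := by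
  have hreal : ∀ u v : ℂ, (u * (starRingEnd ℂ) v).im = 0 ↔
      u * (starRingEnd ℂ) v = v * (starRingEnd ℂ) u := fun u v ↦ by
    rw [← Complex.conj_eq_iff_im, map_mul, Complex.conj_conj, mul_comm, eq_comm]
  rw [LinearIndependent.pair_iff, hreal, hreal]
  constructor
  · intro h
    push Not at h
    obtain ⟨s, t, hst, hne⟩ := h
    have h0 := congr_fun hst 0
    have h1 := congr_fun hst 1
    have h2 := congr_fun hst 2
    simp at h0 h1 h2
    have key : ∀ u v : ℂ, s * u + t * (starRingEnd ℂ) u = 0 → s * v + t * (starRingEnd ℂ) v = 0 →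
        u * (starRingEnd ℂ) v = v * (starRingEnd ℂ) u := fun u v hu hv ↦ by
      by_cases hs : s = 0
      · have ht := hne hs
        exact mul_left_cancel₀ ht (by linear_combination u * hv - v * hu)
      · exact mul_left_cancel₀ hs
          (by linear_combination (starRingEnd ℂ) v * hu - (starRingEnd ℂ) u * hv)
    exact ⟨key _ _ h1 h0, key _ _ h2 h1⟩
  · rintro ⟨h1, h2⟩ h
    refine hq (neg_eq_zero.1 (h ((starRingEnd ℂ) q) (-q) ?_).2)
    ext i
    fin_cases i
    · simp; linear_combination -h1
    · simp; ring
    · simp; linear_combination h2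

/-- The number of pairs of positive integers whose sum is less than `d`. -/
theorem ncard_pos_add_lt (d : ℕ) :
    {p : ℤ × ℤ | 0 < p.1 ∧ 0 < p.2 ∧ p.1 + p.2 < d}.Finite ∧
    {p : ℤ × ℤ | 0 < p.1 ∧ 0 < p.2 ∧ p.1 + p.2 < d}.ncard * 2 = (d - 1) * (d - 2) := by
  set T : Finset (Σ _ : ℕ, ℕ) := (Finset.range (d - 1)).sigma fun i ↦ Finset.range i
  have himg : {p : ℤ × ℤ | 0 < p.1 ∧ 0 < p.2 ∧ p.1 + p.2 < d} =
      (fun x : Σ _ : ℕ, ℕ ↦ ((x.2 + 1 : ℤ), (x.1 - x.2 : ℤ))) '' (T : Set (Σ _ : ℕ, ℕ)) := by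
    ext ⟨k, l⟩
    simp only [mem_ofPred_eq, mem_image, Finset.mem_coe, T, Finset.mem_sigma, Finset.mem_range,
      Prod.mk.injEq]
    constructor
    · rintro ⟨hk, hl, hkl⟩
      exact ⟨⟨(k + l - 1).toNat, (k - 1).toNat⟩, ⟨by simp only; omega, by simp only; omega⟩,
        by simp only; omega, by simp only; omega⟩
    · rintro ⟨⟨i, j⟩, ⟨h1, h2⟩, rfl, rfl⟩
      dsimp only at h1 h2 ⊢
      omega
  have hinj : Function.Injective (fun x : Σ _ : ℕ, ℕ ↦ ((x.2 + 1 : ℤ), (x.1 - x.2 : ℤ))) := by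
    rintro ⟨i, j⟩ ⟨i', j'⟩ h
    simp only [Prod.mk.injEq] at h
    obtain rfl : j = j' := by omega
    obtain rfl : i = i' := by omega
    rfl
  rw [himg]
  refine ⟨T.finite_toSet.image _, ?_⟩
  rw [ncard_image_of_injective _ hinj, ncard_coe_finset, Finset.card_sigma]
  simp only [Finset.card_range]
  rw [Finset.sum_range_id_mul_two, Nat.sub_sub]

/-- With the block polynomials `F, G, H` of a rational simple
Harnack parametrization of degree `d`, the set of non-real parameters `x` for which
the vectors `(F x, G x, H x)` and `(F (conj x), G (conj x), H (conj x))` are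
`ℂ`-linearly dependent has exactly `(d−1)(d−2)` elements. -/
theorem rational_harnack_node_parameters_count
    (d : ℕ) (hd : 1 ≤ d) (a b c : Fin d → ℝ)
    (hab : ∀ i j, a i < b j) (hbc : ∀ j l, b j < c l)
    (F G H : ℂ → ℂ)
    (hF : ∀ x, F x = ∏ i, (x - (a i : ℂ)))
    (hG : ∀ x, G x = ∏ i, (x - (b i : ℂ)))
    (hH : ∀ x, H x = ∏ i, (x - (c i : ℂ)))  :
    {x : ℂ | x ∉ Set.range ((↑) : ℝ → ℂ) ∧
        ¬ LinearIndependent ℂ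
          ![![F x, G x, H x],
            ![F ((starRingEnd ℂ) x), G ((starRingEnd ℂ) x), H ((starRingEnd ℂ) x)]]}.ncard
      = (d - 1) * (d - 2) := by
  have hconj : ∀ (e : Fin d → ℝ) (x : ℂ),
      ∏ i, ((starRingEnd ℂ) x - e i) = (starRingEnd ℂ) (∏ i, (x - e i)) := fun e x ↦ by
    simp [map_prod]
  set R : ℂ → Prop := fun x ↦ (G x * (starRingEnd ℂ) (F x)).im = 0 ∧
    (H x * (starRingEnd ℂ) (G x)).im = 0 with hR
  have hRconj : ∀ x, R ((starRingEnd ℂ) x) ↔ R x := fun x ↦ by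
    simp only [hR, hF, hG, hH, hconj, ← map_mul, Complex.conj_im, neg_eq_zero]
  have hreal : ∀ x : ℂ, x ∉ Set.range ((↑) : ℝ → ℂ) ↔ x.im ≠ 0 := fun x ↦ by
    rw [not_iff_not]
    exact ⟨by rintro ⟨r, rfl⟩; simp, fun h ↦ ⟨x.re, Complex.ext rfl h.symm⟩⟩
  set P := {x : ℂ | 0 < x.im ∧ R x} with hP
  have hset : {x : ℂ | x ∉ Set.range ((↑) : ℝ → ℂ) ∧
      ¬ LinearIndependent ℂ
        ![![F x, G x, H x],
          ![F ((starRingEnd ℂ) x), G ((starRingEnd ℂ) x), H ((starRingEnd ℂ) x)]]} =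
      P ∪ (starRingEnd ℂ) '' P := by
    ext x
    have hmem : x ∈ (starRingEnd ℂ) '' P ↔ x.im < 0 ∧ R x := by
      constructor
      · rintro ⟨y, ⟨hy, hy'⟩, rfl⟩
        exact ⟨by simpa using hy, (hRconj y).2 hy'⟩
      · rintro ⟨h1, h2⟩
        exact ⟨(starRingEnd ℂ) x, ⟨by simpa using h1, (hRconj x).2 h2⟩, Complex.conj_conj x⟩
    rw [mem_union, hmem, mem_ofPred_eq, hreal]
    have hdep (hx : x.im ≠ 0) : _ ↔ R x := not_linearIndependent_conj_iff (p := F x) (q := G x)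
      (r := H x) (by
        rw [hG]
        refine Finset.prod_ne_zero_iff.2 fun i _ h ↦ hx ?_
        simpa using congr_arg Complex.im h)
    simp only [hF, hG, hH, hconj] at hdep ⊢
    constructor
    · rintro ⟨h1, h2⟩
      have h3 := (hdep h1).1 h2
      exact h1.lt_or_gt.symm.imp (⟨·, h3⟩) (⟨·, h3⟩)
    · rintro (⟨h1, h2⟩ | ⟨h1, h2⟩)
      exacts [⟨h1.ne', (hdep h1.ne').2 h2⟩, ⟨h1.ne, (hdep h1.ne).2 h2⟩]
  have hbij := bijOn_argSum_sub hd hab hbc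
  have hπ := Real.pi_pos
  have hcount : BijOn (fun z ↦ (argSum b z - argSum a z, argSum c z - argSum b z)) P
      ((fun p : ℤ × ℤ ↦ ((p.1 * Real.pi : ℝ), (p.2 * Real.pi : ℝ))) ''
        {p : ℤ × ℤ | 0 < p.1 ∧ 0 < p.2 ∧ p.1 + p.2 < d}) := by
    refine ⟨fun z hz ↦ ?_, hbij.injOn.mono fun z hz ↦ hz.1, ?_⟩
    · obtain ⟨h0, h1, h2⟩ := hz
      rw [hG, hF, im_prod_mul_conj_prod_eq_zero_iff a b h0] at h1
      rw [hH, hG, im_prod_mul_conj_prod_eq_zero_iff b c h0] at h2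
      obtain ⟨k, hk⟩ := h1
      obtain ⟨l, hl⟩ := h2
      obtain ⟨h3, h4, h5⟩ := hbij.mapsTo h0
      dsimp only at h3 h4 h5
      rw [← hk] at h3 h5
      rw [← hl] at h4 h5
      refine ⟨(k, l), ⟨?_, ?_, ?_⟩, Prod.ext hk hl⟩
      · exact_mod_cast pos_of_mul_pos_left h3 hπ.le
      · exact_mod_cast pos_of_mul_pos_left h4 hπ.le
      · rw [← add_mul] at h5
        exact_mod_cast lt_of_mul_lt_mul_right h5 hπ.le
    · rintro _ ⟨⟨k, l⟩, ⟨h1, h2, h3⟩, rfl⟩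
      simp only at h1 h2 h3
      have hmem : ((k * Real.pi : ℝ), (l * Real.pi : ℝ)) ∈
          {p : ℝ × ℝ | 0 < p.1 ∧ 0 < p.2 ∧ p.1 + p.2 < d * Real.pi} := by
        refine ⟨mul_pos (by exact_mod_cast h1) hπ, mul_pos (by exact_mod_cast h2) hπ, ?_⟩
        simp only
        rw [← add_mul]
        exact mul_lt_mul_of_pos_right (by exact_mod_cast h3) hπ
      obtain ⟨z, hz, hzk⟩ := hbij.surjOn hmem
      refine ⟨z, ⟨hz, ?_, ?_⟩, hzk⟩
      · rw [hG, hF, im_prod_mul_conj_prod_eq_zero_iff a b hz]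
        exact ⟨k, (congr_arg Prod.fst hzk).symm⟩
      · rw [hH, hG, im_prod_mul_conj_prod_eq_zero_iff b c hz]
        exact ⟨l, (congr_arg Prod.snd hzk).symm⟩
  have hinj : Function.Injective
      (fun p : ℤ × ℤ ↦ ((p.1 * Real.pi : ℝ), (p.2 * Real.pi : ℝ))) := by
    rintro ⟨k, l⟩ ⟨k', l'⟩ h
    simpa [hπ.ne'] using h
  obtain ⟨hfin, hcard⟩ := ncard_pos_add_lt d
  have hPfin : P.Finite := hcount.finite_iff_finite.2 (hfin.image _)
  have hPcard : P.ncard * 2 = (d - 1) * (d - 2) := by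
    rw [← hcard, ← ncard_image_of_injective _ hinj, ← hcount.image_eq, hcount.injOn.ncard_image]
  have hdisj : Disjoint P ((starRingEnd ℂ) '' P) := by
    rw [Set.disjoint_left]
    rintro _ ⟨h1, -⟩ ⟨y, ⟨h2, -⟩, rfl⟩
    rw [Complex.conj_im] at h1
    linarith
  rw [hset, ncard_union_eq hdisj hPfin (hPfin.image _),
    ncard_image_of_injective _ (starRingEnd ℂ).injective, ← mul_two, hPcard]
end

section
/- Let d ≥ 1 be an integer. If x, y ∈ ℂ satisfy x^d = y^d and (x−1)^d = (y−1)^d and x ≠ y, then y = conj(x). -/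
theorem Complex.normSq_eq_of_pow_eq {d : ℕ} (hd : d ≠ 0) {x y : ℂ} (h : x ^ d = y ^ d) :
    Complex.normSq x = Complex.normSq y := by
  have hn := congrArg Complex.normSq h
  rw [map_pow, map_pow] at hn
  exact (pow_left_inj₀ (Complex.normSq_nonneg x) (Complex.normSq_nonneg y) hd).mp hn


/-- For `d ≥ 1`, if `x ^ d = y ^ d` and `(x − 1) ^ d = (y − 1) ^ d`
with `x ≠ y`, then `y = conj x`: all double points of the rational simple Harnack
curve `x ↦ (x ^ d, (x − 1) ^ d)` come from pairs of complex-conjugate parameters. -/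
theorem harnack_power_map_double_points_are_conjugate
    (d : ℕ) (hd : 1 ≤ d) (x y : ℂ)
    (h1 : x ^ d = y ^ d) (h2 : (x - 1) ^ d = (y - 1) ^ d) (hxy : x ≠ y) :
    y = (starRingEnd ℂ) x := by
  have e1 := Complex.normSq_eq_of_pow_eq (by omega) h1
  have e2 := Complex.normSq_eq_of_pow_eq (by omega) h2
  simp only [Complex.normSq_apply, Complex.sub_re, Complex.sub_im, Complex.one_re,
    Complex.one_im] at e1 e2
  have hre : y.re = x.re := by linarith
  have him : y.im ^ 2 = x.im ^ 2 := by
    rw [hre] at e1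
    linarith
  rcases sq_eq_sq_iff_eq_or_eq_neg.mp him with him | him
  · exact absurd (Complex.ext hre.symm him.symm) hxy
  · exact Complex.ext (by simpa using hre) (by simpa using him)
end

section
/- Let d ≥ 1 be an integer. For all a, b ∈ ℂ, the set {x ∈ ℂ : x^d = a and (x−1)^d = b} has at most two elements. -/
/-- A complex number is determined up to conjugation by its distances to `0` and `1`. -/
theorem Complex.eq_or_eq_conj_of_norm_eq_of_norm_sub_one_eq {x p : ℂ}
    (h₀ : ‖x‖ = ‖p‖) (h₁ : ‖x - 1‖ = ‖p - 1‖) : x = p ∨ x = (starRingEnd ℂ) p := by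
  have e₀ : Complex.normSq x = Complex.normSq p := by
    rw [Complex.normSq_eq_norm_sq, Complex.normSq_eq_norm_sq, h₀]
  have e₁ : Complex.normSq (x - 1) = Complex.normSq (p - 1) := by
    rw [Complex.normSq_eq_norm_sq, Complex.normSq_eq_norm_sq, h₁]
  simp only [Complex.normSq_apply, Complex.sub_re, Complex.sub_im, Complex.one_re,
    Complex.one_im, sub_zero] at e₀ e₁
  have hre : x.re = p.re := by linarith
  have him : x.im * x.im = p.im * p.im := by rw [hre] at e₀; linarith
  rcases mul_self_eq_mul_self_iff.mp him with h | h
  · exact Or.inl (Complex.ext hre h)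
  · exact Or.inr (Complex.ext (by simpa using hre) (by simpa using h))

/-- For `d ≥ 1` and any `a, b ∈ ℂ`, the fiber
`{x : ℂ | x ^ d = a ∧ (x − 1) ^ d = b}` of the parametrization
`x ↦ (x ^ d, (x − 1) ^ d)` has at most two elements. -/
theorem harnack_power_map_fibers_le_two
    (d : ℕ) (hd : 1 ≤ d) (a b : ℂ) :
    ∃ u v : ℂ, {x : ℂ | x ^ d = a ∧ (x - 1) ^ d = b} ⊆ {u, v} := by
  have norm_eq {z w : ℂ} (h : z ^ d = w ^ d) : ‖z‖ = ‖w‖ :=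
    (pow_left_inj₀ (norm_nonneg z) (norm_nonneg w) (Nat.one_le_iff_ne_zero.mp hd)).mp
      (by rw [← norm_pow, ← norm_pow, h])
  rcases Set.eq_empty_or_nonempty {x : ℂ | x ^ d = a ∧ (x - 1) ^ d = b} with h | ⟨p, hp₀, hp₁⟩
  · exact ⟨0, 0, h ▸ Set.empty_subset _⟩
  · refine ⟨p, (starRingEnd ℂ) p, fun x ⟨hx₀, hx₁⟩ => ?_⟩
    exact Complex.eq_or_eq_conj_of_norm_eq_of_norm_sub_one_eq
      (norm_eq (hx₀.trans hp₀.symm)) (norm_eq (hx₁.trans hp₁.symm))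
end

section
/- Let d ≥ 1 be an integer and let x ∈ ℂ be non-real with x^d ∈ ℝ and (x−1)^d ∈ ℝ. Then {y ∈ ℂ : y^d = x^d and (y−1)^d = (x−1)^d} = {x, conj(x)}, a set with exactly two elements. -/
/-- A complex number is determined up to conjugation by its distances to `0` and `1`. -/
theorem Complex.eq_or_eq_conj_of_norm_eq {x y : ℂ} (h0 : ‖y‖ = ‖x‖) (h1 : ‖y - 1‖ = ‖x - 1‖) :
    y = x ∨ y = (starRingEnd ℂ) x := by
  have e0 : y.re * y.re + y.im * y.im = x.re * x.re + x.im * x.im := by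
    have h := congrArg (· ^ 2) h0
    simpa only [Complex.sq_norm, Complex.normSq_apply] using h
  have e1 : (y.re - 1) * (y.re - 1) + y.im * y.im = (x.re - 1) * (x.re - 1) + x.im * x.im := by
    have h := congrArg (· ^ 2) h1
    simpa only [Complex.sq_norm, Complex.normSq_apply, Complex.sub_re, Complex.sub_im,
      Complex.one_re, Complex.one_im, sub_zero] using h
  have hre : y.re = x.re := by linarith
  have him : y.im * y.im = x.im * x.im := by rw [hre] at e0; linarith
  rcases mul_self_eq_mul_self_iff.mp him with h | h
  · exact Or.inl (Complex.ext hre h)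
  · exact Or.inr (Complex.ext (by simpa using hre) (by simpa using h))

/-- For `d ≥ 1` and a non-real `x ∈ ℂ` with `x ^ d` and `(x − 1) ^ d`
both real, the fiber `{y : ℂ | y ^ d = x ^ d ∧ (y − 1) ^ d = (x − 1) ^ d}` is exactly
`{x, conj x}`, a set with precisely two elements. -/
theorem harnack_power_map_solitary_node_fiber
    (d : ℕ) (hd : 1 ≤ d) (x : ℂ)
    (hx : x ∉ Set.range ((↑) : ℝ → ℂ))
    (h1 : x ^ d ∈ Set.range ((↑) : ℝ → ℂ))
    (h2 : (x - 1) ^ d ∈ Set.range ((↑) : ℝ → ℂ)) :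
    {y : ℂ | y ^ d = x ^ d ∧ (y - 1) ^ d = (x - 1) ^ d}
        = {x, (starRingEnd ℂ) x} ∧
    {y : ℂ | y ^ d = x ^ d ∧ (y - 1) ^ d = (x - 1) ^ d}.ncard = 2 := by
  have hset : {y : ℂ | y ^ d = x ^ d ∧ (y - 1) ^ d = (x - 1) ^ d} = {x, (starRingEnd ℂ) x} := by
    have hd0 : d ≠ 0 := Nat.one_le_iff_ne_zero.mp hd
    have norm_eq {a b : ℂ} (h : a ^ d = b ^ d) : ‖a‖ = ‖b‖ := by
      have h' := congrArg norm h
      rw [norm_pow, norm_pow] at h'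
      exact (pow_left_inj₀ (norm_nonneg a) (norm_nonneg b) hd0).mp h'
    ext y
    simp only [Set.mem_ofPred_eq, Set.mem_insert_iff, Set.mem_singleton_iff]
    constructor
    · rintro ⟨h, h'⟩
      exact Complex.eq_or_eq_conj_of_norm_eq (norm_eq h) (norm_eq h')
    · rintro (rfl | rfl)
      · exact ⟨rfl, rfl⟩
      · obtain ⟨a, ha⟩ := h1
        obtain ⟨b, hb⟩ := h2
        constructor
        · rw [← map_pow, ← ha, Complex.conj_ofReal]
        · rw [← map_one (starRingEnd ℂ), ← map_sub, ← map_pow, map_one, ← hb,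
            Complex.conj_ofReal]
  refine ⟨hset, ?_⟩
  rw [hset]
  refine Set.ncard_pair fun h => hx ?_
  obtain ⟨r, hr⟩ := Complex.conj_eq_iff_real.mp h.symm
  exact ⟨r, hr.symm⟩
end

section
/- Let d ≥ 1 be an integer. The map (ζ, ξ) ↦ (1−ξ)/(ζ−ξ) is a bijection from the set {(ζ, ξ) ∈ ℂ × ℂ : ζ^d = 1, ξ^d = 1, ζ ≠ 1, ξ ≠ 1, ζ ≠ ξ} onto the set {x ∈ ℂ : x ∉ ℝ, x^d ∈ ℝ, (x−1)^d ∈ ℝ}. -/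
open ComplexConjugate in
/-- A complex number is real if and only if it is fixed by conjugation. -/
lemma Complex.mem_range_ofReal_iff_conj_eq (z : ℂ) :
    z ∈ Set.range ((↑) : ℝ → ℂ) ↔ conj z = z := by
  rw [Complex.conj_eq_iff_real]
  exact ⟨fun ⟨r, hr⟩ => ⟨r, hr.symm⟩, fun ⟨r, hr⟩ => ⟨r, hr.symm⟩⟩

open ComplexConjugate in
lemma Complex.conj_eq_inv_of_pow_eq_one {z : ℂ} {d : ℕ} (hd : d ≠ 0) (hz : z ^ d = 1) :
    conj z = z⁻¹ :=
  (Complex.inv_eq_conj (Complex.norm_eq_one_of_pow_eq_one hz hd)).symm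

open ComplexConjugate in
/-- The point `x = (1 - ξ) / (ζ - ξ)` satisfies `conj x = ζ * x` and
`conj (x - 1) = ξ * (x - 1)`. -/
lemma Complex.conj_one_sub_div_sub {ζ ξ : ℂ} (hζ : conj ζ = ζ⁻¹) (hξ : conj ξ = ξ⁻¹)
    (hζ0 : ζ ≠ 0) (hξ0 : ξ ≠ 0) (hne : ζ ≠ ξ) :
    conj ((1 - ξ) / (ζ - ξ)) = ζ * ((1 - ξ) / (ζ - ξ)) ∧
      conj ((1 - ξ) / (ζ - ξ) - 1) = ξ * ((1 - ξ) / (ζ - ξ) - 1) := by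
  have h1 : ζ - ξ ≠ 0 := sub_ne_zero.mpr hne
  have h2 : ξ - ζ ≠ 0 := sub_ne_zero.mpr hne.symm
  have h3 : ζ⁻¹ - ξ⁻¹ = (ξ - ζ) / (ζ * ξ) := by field_simp
  have h4 : conj ((1 - ξ) / (ζ - ξ)) = ζ * ((1 - ξ) / (ζ - ξ)) := by
    rw [map_div₀, map_sub, map_sub, map_one, hζ, hξ, h3, ← neg_sub ζ ξ]
    field_simp
    ring
  refine ⟨h4, ?_⟩
  rw [map_sub, map_one, h4]
  field_simp
  ring

open ComplexConjugate in
lemma Complex.conj_div_self_pow_eq_one {z : ℂ} {d : ℕ} (hz : z ≠ 0)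
    (h : conj (z ^ d) = z ^ d) : (conj z / z) ^ d = 1 := by
  rw [div_pow, ← map_pow, h, div_self (pow_ne_zero d hz)]

/-- For `d ≥ 1`, the map `(ζ, ξ) ↦ (1 − ξ) / (ζ − ξ)` is a bijection
from the set of pairs of `d`-th roots of unity `(ζ, ξ)` with `ζ ≠ 1`, `ξ ≠ 1`, `ζ ≠ ξ`
onto the set of non-real `x ∈ ℂ` with `x ^ d` and `(x − 1) ^ d` both real. -/
theorem harnack_power_map_node_parameters_bijection
    (d : ℕ) (hd : 1 ≤ d) :
    Set.BijOn (fun p : ℂ × ℂ => (1 - p.2) / (p.1 - p.2))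
      {p : ℂ × ℂ | p.1 ^ d = 1 ∧ p.2 ^ d = 1 ∧ p.1 ≠ 1 ∧ p.2 ≠ 1 ∧ p.1 ≠ p.2}
      {x : ℂ | x ∉ Set.range ((↑) : ℝ → ℂ) ∧
        x ^ d ∈ Set.range ((↑) : ℝ → ℂ) ∧
        (x - 1) ^ d ∈ Set.range ((↑) : ℝ → ℂ)} := by
  have hd0 : d ≠ 0 := by omega
  have key : ∀ ζ ξ : ℂ, ζ ^ d = 1 → ξ ^ d = 1 → ζ ≠ ξ →
      (starRingEnd ℂ) ((1 - ξ) / (ζ - ξ)) = ζ * ((1 - ξ) / (ζ - ξ)) ∧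
        (starRingEnd ℂ) ((1 - ξ) / (ζ - ξ) - 1) = ξ * ((1 - ξ) / (ζ - ξ) - 1) :=
    fun ζ ξ hζ hξ hne => Complex.conj_one_sub_div_sub
      (Complex.conj_eq_inv_of_pow_eq_one hd0 hζ) (Complex.conj_eq_inv_of_pow_eq_one hd0 hξ)
      (ne_zero_pow hd0 (by simp [hζ])) (ne_zero_pow hd0 (by simp [hξ])) hne
  have hx0 : ∀ ζ ξ : ℂ, ξ ≠ 1 → ζ ≠ ξ → (1 - ξ) / (ζ - ξ) ≠ 0 := fun ζ ξ hξ hne =>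
    div_ne_zero (sub_ne_zero.mpr hξ.symm) (sub_ne_zero.mpr hne)
  have hx1 : ∀ ζ ξ : ℂ, ζ ≠ 1 → ζ ≠ ξ → (1 - ξ) / (ζ - ξ) - 1 ≠ 0 := by
    intro ζ ξ hζ hne
    rw [div_sub_one (sub_ne_zero.mpr hne), sub_sub_sub_cancel_right]
    exact div_ne_zero (sub_ne_zero.mpr hζ.symm) (sub_ne_zero.mpr hne)
  simp only [Complex.mem_range_ofReal_iff_conj_eq]
  refine ⟨?_, ?_, ?_⟩
  · rintro ⟨ζ, ξ⟩ ⟨hζ, hξ, hζ1, hξ1, hne⟩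
    obtain ⟨h1, h2⟩ := key ζ ξ hζ hξ hne
    refine ⟨fun h => ?_, ?_, ?_⟩
    · exact hζ1 (mul_eq_right₀ (hx0 ζ ξ hξ1 hne) |>.mp (h1.symm.trans h))
    · dsimp only at hζ ⊢
      rw [map_pow, h1, mul_pow, hζ, one_mul]
    · dsimp only at hξ ⊢
      rw [map_pow, h2, mul_pow, hξ, one_mul]
  · rintro ⟨ζ, ξ⟩ ⟨hζ, hξ, hζ1, hξ1, hne⟩ ⟨ζ', ξ'⟩ ⟨hζ', hξ', -, -, hne'⟩ h
    dsimp only at hζ hξ hζ1 hξ1 hne hζ' hξ' hne' h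
    obtain ⟨h1, h2⟩ := key ζ ξ hζ hξ hne
    obtain ⟨h1', h2'⟩ := key ζ' ξ' hζ' hξ' hne'
    rw [← h] at h1' h2'
    exact Prod.ext (mul_right_cancel₀ (hx0 ζ ξ hξ1 hne) (h1.symm.trans h1'))
      (mul_right_cancel₀ (hx1 ζ ξ hζ1 hne) (h2.symm.trans h2'))
  · rintro x ⟨hx, hxd, hxd'⟩
    have h0 : x ≠ 0 := by rintro rfl; simp at hx
    have h1 : x - 1 ≠ 0 := by
      intro h
      rw [sub_eq_zero.mp h] at hx
      simp at hx
    have hsub : (starRingEnd ℂ) x / x - (starRingEnd ℂ) (x - 1) / (x - 1) = (x - (starRingEnd ℂ) x) / (x * (x - 1)) := by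
      rw [map_sub, map_one]
      field_simp
      ring
    have hx' : x - (starRingEnd ℂ) x ≠ 0 := sub_ne_zero.mpr (Ne.symm hx)
    refine ⟨((starRingEnd ℂ) x / x, (starRingEnd ℂ) (x - 1) / (x - 1)),
      ⟨Complex.conj_div_self_pow_eq_one h0 hxd, Complex.conj_div_self_pow_eq_one h1 hxd',
        ?_, ?_, ?_⟩, ?_⟩
    · exact fun h => hx ((div_eq_one_iff_eq h0).mp h)
    · intro h
      have h2 := (div_eq_one_iff_eq h1).mp h
      rw [map_sub, map_one] at h2
      exact hx (sub_left_injective h2)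
    · rw [← sub_ne_zero, hsub]
      exact div_ne_zero hx' (mul_ne_zero h0 h1)
    · dsimp only
      rw [hsub, map_sub, map_one]
      field_simp
      ring
end

section
/- Let k ≥ 1 and d = 2k. Among the non-real x ∈ ℂ with x^d ∈ ℝ and (x−1)^d ∈ ℝ (the solitary-node parameters of the degree-d rational simple Harnack curve x ↦ (x^d, (x−1)^d)): exactly (k−1)(k−2) satisfy x^d > 0 and (x−1)^d > 0, exactly k(k−1) satisfy x^d > 0 and (x−1)^d < 0, exactly k(k−1) satisfy x^d < 0 and (x−1)^d > 0, and exactly k(k−1) satisfy x^d < 0 and (x−1)^d < 0. (Here 'x^d > 0' means x^d is real and positive.) This gives the distribution of the (d−1)(d−2)/2 solitary nodes among the four quadrants of the coordinate triangle, as in the topological classification of simple Harnack curves of genus 0 and even degree. -/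
/-- The point `x` lies on the real line through `0` in direction `exp (i θ)`. -/
def OnLine (θ : ℝ) (x : ℂ) : Prop :=
  x.re * Real.sin θ = x.im * Real.cos θ

lemma OnLine.exists_real_mul_exp {θ : ℝ} {x : ℂ} (h : OnLine θ x) :
    ∃ r : ℝ, x = r * Complex.exp (θ * Complex.I) := by
  unfold OnLine at h
  have h1 := Real.sin_sq_add_cos_sq θ
  refine ⟨x.re * Real.cos θ + x.im * Real.sin θ, ?_⟩
  apply Complex.ext
  · rw [Complex.re_ofReal_mul, Complex.exp_ofReal_mul_I_re]
    linear_combination (-x.re) * h1 + Real.sin θ * h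
  · rw [Complex.im_ofReal_mul, Complex.exp_ofReal_mul_I_im]
    linear_combination (-x.im) * h1 - Real.cos θ * h

lemma OnLine.angle_unique {θ θ' : ℝ} {x : ℂ} (hx : x.im ≠ 0)
    (hθ : θ ∈ Set.Ioo 0 Real.pi) (hθ' : θ' ∈ Set.Ioo 0 Real.pi)
    (h : OnLine θ x) (h' : OnLine θ' x) : θ = θ' := by
  unfold OnLine at h h'
  have hs : Real.sin (θ - θ') = 0 := by
    rw [Real.sin_sub]
    apply mul_left_cancel₀ hx
    linear_combination Real.sin θ' * h - Real.sin θ * h'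
  have := (Real.sin_eq_zero_iff_of_lt_of_lt (by linarith [hθ.1, hθ'.2])
    (by linarith [hθ.2, hθ'.1])).1 hs
  linarith

/-- The intersection of the line through `0` at angle `α` and the line through `1` at angle `β`. -/
noncomputable def lineInter (α β : ℝ) : ℂ :=
  ⟨Real.cos α * Real.sin β / Real.sin (β - α), Real.sin α * Real.sin β / Real.sin (β - α)⟩

lemma sin_sub_ne_zero_of_mem_Ioo {α β : ℝ} (hα : α ∈ Set.Ioo 0 Real.pi)
    (hβ : β ∈ Set.Ioo 0 Real.pi) (hne : α ≠ β) : Real.sin (β - α) ≠ 0 := by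
  intro hs
  have := (Real.sin_eq_zero_iff_of_lt_of_lt (by linarith [hα.2, hβ.1])
    (by linarith [hα.1, hβ.2])).1 hs
  exact hne (by linarith)

lemma lineInter_im_ne_zero {α β : ℝ} (hα : α ∈ Set.Ioo 0 Real.pi)
    (hβ : β ∈ Set.Ioo 0 Real.pi) (hne : α ≠ β) : (lineInter α β).im ≠ 0 :=
  div_ne_zero (mul_ne_zero (Real.sin_pos_of_mem_Ioo hα).ne' (Real.sin_pos_of_mem_Ioo hβ).ne')
    (sin_sub_ne_zero_of_mem_Ioo hα hβ hne)

lemma onLine_lineInter (α β : ℝ) : OnLine α (lineInter α β) := by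
  simp only [OnLine, lineInter]
  ring

lemma onLine_lineInter_sub_one {α β : ℝ} (h : Real.sin (β - α) ≠ 0) :
    OnLine β (lineInter α β - 1) := by
  simp only [OnLine, lineInter, Complex.sub_re, Complex.sub_im, Complex.one_re, Complex.one_im]
  field_simp
  rw [Real.sin_sub]
  ring

lemma eq_lineInter {α β : ℝ} {x : ℂ} (h : Real.sin (β - α) ≠ 0)
    (hα : OnLine α x) (hβ : OnLine β (x - 1)) : x = lineInter α β := by
  simp only [OnLine, Complex.sub_re, Complex.sub_im, Complex.one_re, Complex.one_im] at hα hβ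
  apply Complex.ext
  · simp only [lineInter]
    rw [eq_div_iff h, Real.sin_sub]
    linear_combination Real.cos α * hβ - Real.cos β * hα
  · simp only [lineInter]
    rw [eq_div_iff h, Real.sin_sub]
    linear_combination Real.sin α * hβ - Real.sin β * hα

lemma nat_mul_pi_div_mem_Ioo {d p : ℕ} (hp : p ∈ Finset.Ioo 0 d) :
    (p * Real.pi / d : ℝ) ∈ Set.Ioo 0 Real.pi := by
  obtain ⟨h0, h1⟩ := Finset.mem_Ioo.1 hp
  have hd : (0 : ℝ) < d := by exact_mod_cast h0.trans h1
  have h0' : (0 : ℝ) < p := by exact_mod_cast h0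
  have h1' : (p : ℝ) < d := by exact_mod_cast h1
  have := Real.pi_pos
  refine ⟨by positivity, ?_⟩
  rw [div_lt_iff₀ hd]
  nlinarith

lemma nat_mul_pi_div_injective {d : ℕ} (hd : d ≠ 0) :
    Function.Injective fun p : ℕ => (p * Real.pi / d : ℝ) := by
  intro p q h
  have hd' : (d : ℝ) ≠ 0 := by exact_mod_cast hd
  have := Real.pi_ne_zero
  simp only at h
  field_simp at h
  exact_mod_cast h

lemma ncard_onLine_inter {d : ℕ} {P Q : Finset ℕ} (hP : P ⊆ Finset.Ioo 0 d)
    (hQ : Q ⊆ Finset.Ioo 0 d) :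
    {x : ℂ | x.im ≠ 0 ∧ (∃ p ∈ P, OnLine (p * Real.pi / d) x) ∧
      ∃ q ∈ Q, OnLine (q * Real.pi / d) (x - 1)}.ncard =
      ((P ×ˢ Q).filter fun z => z.1 ≠ z.2).card := by
  have hne : ∀ z ∈ (P ×ˢ Q).filter fun z => z.1 ≠ z.2,
      (z.1 * Real.pi / d : ℝ) ∈ Set.Ioo 0 Real.pi ∧ (z.2 * Real.pi / d : ℝ) ∈ Set.Ioo 0 Real.pi ∧
        (z.1 * Real.pi / d : ℝ) ≠ z.2 * Real.pi / d := by
    intro z hz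
    simp only [Finset.mem_filter, Finset.mem_product] at hz
    have h1 := hP hz.1.1
    have hd : d ≠ 0 := by have := Finset.mem_Ioo.1 h1; omega
    exact ⟨nat_mul_pi_div_mem_Ioo h1, nat_mul_pi_div_mem_Ioo (hQ hz.1.2),
      fun h => hz.2 (nat_mul_pi_div_injective hd h)⟩
  rw [← Set.ncard_coe_finset]
  symm
  refine Set.ncard_congr (fun z _ => lineInter (z.1 * Real.pi / d) (z.2 * Real.pi / d)) ?_ ?_ ?_
  · intro z hz
    obtain ⟨h1, h2, h3⟩ := hne z hz
    have hz' := Finset.mem_product.1 (Finset.mem_filter.1 hz).1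
    exact ⟨lineInter_im_ne_zero h1 h2 h3, ⟨z.1, hz'.1, onLine_lineInter _ _⟩,
      ⟨z.2, hz'.2, onLine_lineInter_sub_one (sin_sub_ne_zero_of_mem_Ioo h1 h2 h3)⟩⟩
  · intro z w hz hw h
    obtain ⟨h1, h2, h3⟩ := hne z hz
    obtain ⟨h1', h2', h3'⟩ := hne w hw
    have hd : d ≠ 0 := by
      have := Finset.mem_Ioo.1 (hP (Finset.mem_product.1 (Finset.mem_filter.1 hz).1).1)
      omega
    have him := lineInter_im_ne_zero h1 h2 h3
    have e1 := onLine_lineInter (z.1 * Real.pi / d) (z.2 * Real.pi / d)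
    have e2 := onLine_lineInter_sub_one (sin_sub_ne_zero_of_mem_Ioo h1 h2 h3)
    have f1 := onLine_lineInter (w.1 * Real.pi / d) (w.2 * Real.pi / d)
    have f2 := onLine_lineInter_sub_one (sin_sub_ne_zero_of_mem_Ioo h1' h2' h3')
    rw [← h] at f1 f2
    exact Prod.ext (nat_mul_pi_div_injective hd (e1.angle_unique him h1 h1' f1))
      (nat_mul_pi_div_injective hd (e2.angle_unique (by simpa using him) h2 h2' f2))
  · rintro x ⟨him, ⟨p, hp, hpx⟩, ⟨q, hq, hqx⟩⟩
    have hpq : p ≠ q := by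
      rintro rfl
      have hs := Real.sin_pos_of_mem_Ioo (nat_mul_pi_div_mem_Ioo (hP hp))
      simp only [OnLine, Complex.sub_re, Complex.sub_im, Complex.one_re, Complex.one_im]
        at hpx hqx
      linarith
    have hz : (p, q) ∈ (P ×ˢ Q).filter fun z => z.1 ≠ z.2 := by
      simp [hp, hq, hpq]
    obtain ⟨h1, h2, h3⟩ := hne _ hz
    exact ⟨(p, q), hz, (eq_lineInter (sin_sub_ne_zero_of_mem_Ioo h1 h2 h3) hpx hqx).symm⟩

lemma OnLine.exists_pow_eq {d p : ℕ} (hd : Even d) (hd0 : d ≠ 0) {x : ℂ} (hx : x ≠ 0)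
    (h : OnLine (p * Real.pi / d) x) : ∃ r : ℝ, 0 < r ∧ x ^ d = ((r * (-1) ^ p : ℝ) : ℂ) := by
  obtain ⟨r, rfl⟩ := h.exists_real_mul_exp
  have hr : r ≠ 0 := by rintro rfl; simp at hx
  refine ⟨r ^ d, hd.pow_pos hr, ?_⟩
  have hd' : (d : ℂ) ≠ 0 := by exact_mod_cast hd0
  rw [mul_pow, ← Complex.exp_nat_mul]
  have : (d : ℂ) * (((p * Real.pi / d : ℝ) : ℂ) * Complex.I) = p * (Real.pi * Complex.I) := by
    push_cast
    field_simp
  rw [this, Complex.exp_nat_mul, Complex.exp_pi_mul_I]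
  push_cast
  rfl

lemma exists_onLine_of_pow_eq_ofReal {d : ℕ} (hd0 : d ≠ 0) {x : ℂ}
    (hx : x.im ≠ 0) {s : ℝ} (h : x ^ d = s) :
    ∃ p ∈ Finset.Ioo 0 d, OnLine (p * Real.pi / d) x := by
  have hd' : (d : ℝ) ≠ 0 := by exact_mod_cast hd0
  have hx0 : x ≠ 0 := by rintro rfl; simp at hx
  have hn : ‖x‖ ≠ 0 := norm_ne_zero_iff.2 hx0
  have hsin : Real.sin (d * x.arg) = 0 := by
    have h1 : x ^ d = ((‖x‖ ^ d : ℝ) : ℂ) * Complex.exp ((d * x.arg : ℝ) * Complex.I) := by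
      conv_lhs => rw [← Complex.norm_mul_exp_arg_mul_I x]
      rw [mul_pow, ← Complex.exp_nat_mul]
      push_cast
      ring_nf
    have h2 := congrArg Complex.im (h1.symm.trans h)
    rw [Complex.im_ofReal_mul, Complex.exp_ofReal_mul_I_im, Complex.ofReal_im] at h2
    exact (mul_eq_zero.1 h2).resolve_left (pow_ne_zero _ hn)
  obtain ⟨n, hn'⟩ := Real.sin_eq_zero_iff.1 hsin
  have hdz : (0 : ℤ) < d := by omega
  have hp0 := Int.emod_nonneg n hdz.ne'
  obtain ⟨p, hp⟩ := Int.eq_ofNat_of_zero_le hp0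
  have hpd : p < d := by have := Int.emod_lt_of_pos n hdz; omega
  have hmd := Int.emod_add_mul_ediv n d
  rw [hp] at hmd
  have hang : (p * Real.pi / d : ℝ) = x.arg - (n / d : ℤ) * Real.pi := by
    have : (n : ℝ) = p + d * (n / d : ℤ) := by exact_mod_cast hmd.symm
    rw [this] at hn'
    field_simp
    linear_combination hn'
  have hline : OnLine (p * Real.pi / d) x := by
    rw [OnLine, hang, Real.sin_sub_int_mul_pi, Real.cos_sub_int_mul_pi,
      ← Complex.norm_mul_cos_arg, ← Complex.norm_mul_sin_arg]
    ring
  refine ⟨p, Finset.mem_Ioo.2 ⟨Nat.pos_of_ne_zero ?_, hpd⟩, hline⟩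
  rintro rfl
  simp [OnLine] at hline
  exact hx hline.symm

lemma exists_pow_eq_pos_iff {d : ℕ} (hd : Even d) (hd0 : d ≠ 0) {x : ℂ} (hx : x.im ≠ 0) :
    (∃ r : ℝ, x ^ d = (r : ℂ) ∧ 0 < r) ↔
      ∃ p ∈ (Finset.Ioo 0 d).filter Even, OnLine (p * Real.pi / d) x := by
  have hx0 : x ≠ 0 := by rintro rfl; simp at hx
  constructor
  · rintro ⟨s, hs, hpos⟩
    obtain ⟨p, hp, hline⟩ := exists_onLine_of_pow_eq_ofReal hd0 hx hs
    obtain ⟨r, hr, he⟩ := hline.exists_pow_eq hd hd0 hx0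
    have hsr : s = r * (-1) ^ p := by exact_mod_cast hs.symm.trans he
    refine ⟨p, Finset.mem_filter.2 ⟨hp, ?_⟩, hline⟩
    by_contra hodd
    rw [(Nat.not_even_iff_odd.1 hodd).neg_one_pow] at hsr
    linarith
  · rintro ⟨p, hp, hline⟩
    obtain ⟨r, hr, he⟩ := hline.exists_pow_eq hd hd0 hx0
    refine ⟨_, he, ?_⟩
    rwa [(Finset.mem_filter.1 hp).2.neg_one_pow, mul_one]

lemma exists_pow_eq_neg_iff {d : ℕ} (hd : Even d) (hd0 : d ≠ 0) {x : ℂ} (hx : x.im ≠ 0) :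
    (∃ r : ℝ, x ^ d = (r : ℂ) ∧ r < 0) ↔
      ∃ p ∈ (Finset.Ioo 0 d).filter Odd, OnLine (p * Real.pi / d) x := by
  have hx0 : x ≠ 0 := by rintro rfl; simp at hx
  constructor
  · rintro ⟨s, hs, hneg⟩
    obtain ⟨p, hp, hline⟩ := exists_onLine_of_pow_eq_ofReal hd0 hx hs
    obtain ⟨r, hr, he⟩ := hline.exists_pow_eq hd hd0 hx0
    have hsr : s = r * (-1) ^ p := by exact_mod_cast hs.symm.trans he
    refine ⟨p, Finset.mem_filter.2 ⟨hp, ?_⟩, hline⟩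
    by_contra heven
    rw [(Nat.not_odd_iff_even.1 heven).neg_one_pow] at hsr
    linarith
  · rintro ⟨p, hp, hline⟩
    obtain ⟨r, hr, he⟩ := hline.exists_pow_eq hd hd0 hx0
    refine ⟨_, he, ?_⟩
    rw [(Finset.mem_filter.1 hp).2.neg_one_pow]
    linarith

lemma card_filter_even_Ioo (k : ℕ) : ((Finset.Ioo 0 (2 * k)).filter Even).card = k - 1 := by
  have : (Finset.Ioo 0 (2 * k)).filter Even = (Finset.Ioo 0 k).image (2 * ·) := by
    ext n
    simp only [Finset.mem_filter, Finset.mem_Ioo, Finset.mem_image]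
    constructor
    · rintro ⟨h, m, rfl⟩
      exact ⟨m, by omega, by omega⟩
    · rintro ⟨m, h, rfl⟩
      exact ⟨by omega, even_two_mul m⟩
  rw [this, Finset.card_image_of_injective _ fun a b h => by simpa using h, Nat.card_Ioo,
    Nat.sub_zero]

lemma card_filter_odd_Ioo (k : ℕ) : ((Finset.Ioo 0 (2 * k)).filter Odd).card = k := by
  have : (Finset.Ioo 0 (2 * k)).filter Odd = (Finset.range k).image (2 * · + 1) := by
    ext n
    simp only [Finset.mem_filter, Finset.mem_Ioo, Finset.mem_image, Finset.mem_range]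
    constructor
    · rintro ⟨h, m, rfl⟩
      exact ⟨m, by omega, rfl⟩
    · rintro ⟨m, h, rfl⟩
      exact ⟨by omega, odd_two_mul_add_one m⟩
  rw [this, Finset.card_image_of_injective _ fun a b h => by simpa using h, Finset.card_range]

lemma card_filter_product_self_ne {α : Type*} [DecidableEq α] (P : Finset α) :
    ((P ×ˢ P).filter fun z => z.1 ≠ z.2).card = P.card * (P.card - 1) := by
  rw [Nat.mul_sub_one, ← Finset.offDiag_card]
  congr 1 with z
  simp [and_assoc]

lemma card_filter_product_ne_of_disjoint {α : Type*} [DecidableEq α] {P Q : Finset α}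
    (h : Disjoint P Q) : ((P ×ˢ Q).filter fun z => z.1 ≠ z.2).card = P.card * Q.card := by
  rw [Finset.filter_true_of_mem, Finset.card_product]
  intro z hz
  rw [Finset.mem_product] at hz
  exact Finset.disjoint_iff_ne.1 h _ hz.1 _ hz.2

lemma notMem_range_ofReal_iff (x : ℂ) : x ∉ Set.range ((↑) : ℝ → ℂ) ↔ x.im ≠ 0 := by
  rw [not_iff_not]
  exact ⟨by rintro ⟨r, rfl⟩; simp, fun h => ⟨x.re, Complex.ext (by simp) (by simp [h])⟩⟩


/-- Let `d = 2k` with `k ≥ 1`. Among the non-real `x ∈ ℂ` with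
`x ^ d` and `(x − 1) ^ d` real (the solitary-node parameters of the degree-`d`
rational simple Harnack curve `x ↦ (x ^ d, (x − 1) ^ d)`), exactly `(k−1)(k−2)` have
`x ^ d > 0` and `(x−1) ^ d > 0`, and exactly `k(k−1)` lie in each of the three other
sign quadrants. -/
theorem harnack_power_map_node_distribution_even
    (k : ℕ) (hk : 1 ≤ k) (d : ℕ) (hd : d = 2 * k) :
    ({x : ℂ | (x ∉ Set.range ((↑) : ℝ → ℂ)) ∧
        (∃ r : ℝ, x ^ d = (r : ℂ) ∧ 0 < r) ∧
        (∃ s : ℝ, (x - 1) ^ d = (s : ℂ) ∧ 0 < s)}.ncard = (k - 1) * (k - 2)) ∧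
    ({x : ℂ | (x ∉ Set.range ((↑) : ℝ → ℂ)) ∧
        (∃ r : ℝ, x ^ d = (r : ℂ) ∧ 0 < r) ∧
        (∃ s : ℝ, (x - 1) ^ d = (s : ℂ) ∧ s < 0)}.ncard = k * (k - 1)) ∧
    ({x : ℂ | (x ∉ Set.range ((↑) : ℝ → ℂ)) ∧
        (∃ r : ℝ, x ^ d = (r : ℂ) ∧ r < 0) ∧
        (∃ s : ℝ, (x - 1) ^ d = (s : ℂ) ∧ 0 < s)}.ncard = k * (k - 1)) ∧
    ({x : ℂ | (x ∉ Set.range ((↑) : ℝ → ℂ)) ∧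
        (∃ r : ℝ, x ^ d = (r : ℂ) ∧ r < 0) ∧
        (∃ s : ℝ, (x - 1) ^ d = (s : ℂ) ∧ s < 0)}.ncard = k * (k - 1)) := by
  subst hd
  have hd0 : 2 * k ≠ 0 := by omega
  have heven : Even (2 * k) := even_two_mul k
  have hsub : ∀ x : ℂ, x.im ≠ 0 → (x - 1).im ≠ 0 := fun x hx => by simpa using hx
  have hE := Finset.filter_subset Even (Finset.Ioo 0 (2 * k))
  have hO := Finset.filter_subset Odd (Finset.Ioo 0 (2 * k))
  have hdisj : Disjoint ((Finset.Ioo 0 (2 * k)).filter Even)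
      ((Finset.Ioo 0 (2 * k)).filter Odd) := by
    refine Finset.disjoint_filter.2 fun p _ h => ?_
    rwa [Nat.not_odd_iff_even]
  simp only [notMem_range_ofReal_iff]
  refine ⟨?_, ?_, ?_, ?_⟩
  · trans ((Finset.Ioo 0 (2 * k)).filter Even).card *
      (((Finset.Ioo 0 (2 * k)).filter Even).card - 1)
    · rw [← card_filter_product_self_ne, ← ncard_onLine_inter hE hE]
      congr 1 with x
      exact and_congr_right fun hx => and_congr (exists_pow_eq_pos_iff heven hd0 hx)
        (exists_pow_eq_pos_iff heven hd0 (hsub x hx))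
    · rw [card_filter_even_Ioo, Nat.sub_sub]
  · trans ((Finset.Ioo 0 (2 * k)).filter Even).card * ((Finset.Ioo 0 (2 * k)).filter Odd).card
    · rw [← card_filter_product_ne_of_disjoint hdisj, ← ncard_onLine_inter hE hO]
      congr 1 with x
      exact and_congr_right fun hx => and_congr (exists_pow_eq_pos_iff heven hd0 hx)
        (exists_pow_eq_neg_iff heven hd0 (hsub x hx))
    · rw [card_filter_even_Ioo, card_filter_odd_Ioo, mul_comm]
  · trans ((Finset.Ioo 0 (2 * k)).filter Odd).card * ((Finset.Ioo 0 (2 * k)).filter Even).card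
    · rw [← card_filter_product_ne_of_disjoint hdisj.symm, ← ncard_onLine_inter hO hE]
      congr 1 with x
      exact and_congr_right fun hx => and_congr (exists_pow_eq_neg_iff heven hd0 hx)
        (exists_pow_eq_pos_iff heven hd0 (hsub x hx))
    · rw [card_filter_even_Ioo, card_filter_odd_Ioo]
  · trans ((Finset.Ioo 0 (2 * k)).filter Odd).card * (((Finset.Ioo 0 (2 * k)).filter Odd).card - 1)
    · rw [← card_filter_product_self_ne, ← ncard_onLine_inter hO hO]
      congr 1 with x
      exact and_congr_right fun hx => and_congr (exists_pow_eq_neg_iff heven hd0 hx)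
        (exists_pow_eq_neg_iff heven hd0 (hsub x hx))
    · rw [card_filter_odd_Ioo]
end

section
/- Let d ≥ 1 be an integer and let a_1,…,a_d, b_1,…,b_d, c_1,…,c_d be real numbers with a_i < b_j < c_l for all indices, and F, G, H the corresponding block polynomials. Then for all real t ≠ t', the vectors (F(t), G(t), H(t)) and (F(t'), G(t'), H(t')) in ℂ³ are ℂ-linearly independent. In other words, the real locus of the rational simple Harnack parametrization is an embedded circle: the parametrization is injective on ℝP¹. -/
/-- If two nonnegative families over a nonempty finite type have the same product, some member of
the second is at most the corresponding member of the first. -/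
theorem exists_le_of_prod_eq_prod {ι : Type*} [Fintype ι] [Nonempty ι] {u v : ι → ℝ}
    (hu : ∀ i, 0 ≤ u i) (h : ∏ i, u i = ∏ i, v i) : ∃ i, v i ≤ u i := by
  by_contra! hlt
  by_cases hz : ∃ i, u i = 0
  · obtain ⟨i, hi⟩ := hz
    have hv : 0 < ∏ i, v i := Finset.prod_pos fun i _ => (hu i).trans_lt (hlt i)
    rw [← h, Finset.prod_eq_zero (Finset.mem_univ i) hi] at hv
    exact lt_irrefl _ hv
  · push Not at hz
    exact (Finset.prod_lt_prod_of_nonempty (fun i _ => (hu i).lt_of_ne' (hz i))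
      (fun i _ => hlt i) Finset.univ_nonempty).ne h

/-- If `P ^ d * ∏ |t - r i| = Q ^ d * ∏ |t' - r i|`, then between two of the `r i` there is a point
`x` with `P * |t - x| = Q * |t' - x|`. -/
theorem exists_mem_uIcc_mul_abs_sub_eq {d : ℕ} (hd : 1 ≤ d) (r : Fin d → ℝ) {P Q t t' : ℝ}
    (hP : 0 ≤ P) (hQ : 0 ≤ Q) (h : P ^ d * ∏ i, |t - r i| = Q ^ d * ∏ i, |t' - r i|) :
    ∃ i j, ∃ x ∈ Set.uIcc (r i) (r j), P * |t - x| = Q * |t' - x| := by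
  have : Nonempty (Fin d) := ⟨⟨0, hd⟩⟩
  have h' : ∏ i, P * |t - r i| = ∏ i, Q * |t' - r i| := by
    simpa [Finset.prod_mul_distrib] using h
  obtain ⟨i, hi⟩ := exists_le_of_prod_eq_prod (fun i => by positivity) h'
  obtain ⟨j, hj⟩ := exists_le_of_prod_eq_prod (fun i => by positivity) h'.symm
  have hc : ContinuousOn (fun x => P * |t - x| - Q * |t' - x|) (Set.uIcc (r i) (r j)) := by
    fun_prop
  obtain ⟨x, hx, hfx⟩ := intermediate_value_uIcc hc
    (Set.mem_uIcc.2 (Or.inr ⟨sub_nonpos.2 hj, sub_nonneg.2 hi⟩))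
  exact ⟨i, j, x, hx, sub_eq_zero.1 hfx⟩

/-- Two distinct points cannot satisfy the same linear equation `P * (t - x) = Q * (t' - x)` with
`t ≠ t'` unless `P = Q = 0`. -/
theorem eq_zero_of_mul_sub_eq {P Q t t' x y : ℝ} (ht : t ≠ t') (hxy : x ≠ y)
    (hx : P * (t - x) = Q * (t' - x)) (hy : P * (t - y) = Q * (t' - y)) : P = 0 ∧ Q = 0 := by
  have hPQ : P = Q := mul_right_cancel₀ (sub_ne_zero.2 hxy) (by linear_combination hy - hx)
  subst hPQ
  have hP : P = 0 := by
    by_contra hne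
    exact ht (by simpa using mul_left_cancel₀ hne hx)
  exact ⟨hP, hP⟩

/-- The equation `P * |t - x| = Q * |t' - x|` with `t ≠ t'` has at most two solutions unless
`P = Q = 0`. -/
theorem eq_zero_of_mul_abs_sub_eq {P Q t t' x y z : ℝ} (ht : t ≠ t') (hxy : x < y) (hyz : y < z)
    (hx : P * |t - x| = Q * |t' - x|) (hy : P * |t - y| = Q * |t' - y|)
    (hz : P * |t - z| = Q * |t' - z|) : P = 0 ∧ Q = 0 := by
  have key : ∀ w, P * |t - w| = Q * |t' - w| →
      P * (t - w) = Q * (t' - w) ∨ P * (t - w) = -Q * (t' - w) := fun w hw => by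
    have h2 : |P * (t - w)| = |Q * (t' - w)| := by
      simpa [abs_mul] using congrArg abs hw
    simpa using abs_eq_abs.1 h2
  have hxz := hxy.trans hyz
  rcases key x hx with h1 | h1 <;> rcases key y hy with h2 | h2 <;> rcases key z hz with h3 | h3 <;>
    first
    | exact eq_zero_of_mul_sub_eq ht hxy.ne h1 h2
    | exact eq_zero_of_mul_sub_eq ht hyz.ne h2 h3
    | exact eq_zero_of_mul_sub_eq ht hxz.ne h1 h3
    | simpa using eq_zero_of_mul_sub_eq ht hxy.ne h1 h2
    | simpa using eq_zero_of_mul_sub_eq ht hyz.ne h2 h3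
    | simpa using eq_zero_of_mul_sub_eq ht hxz.ne h1 h3

/-- Taking norms in a linear relation between the values at `t` and `t'` of the polynomial with
real roots `r i`. -/
theorem norm_mul_prod_abs_sub_eq {d : ℕ} (r : Fin d → ℝ) {p q : ℂ} {t t' : ℝ}
    (h : p * ∏ i, ((t : ℂ) - r i) + q * ∏ i, ((t' : ℂ) - r i) = 0) :
    ‖p‖ * ∏ i, |t - r i| = ‖q‖ * ∏ i, |t' - r i| := by
  have h2 := congrArg norm (eq_neg_of_add_eq_zero_left h)
  simpa only [norm_neg, norm_mul, norm_prod, ← Complex.ofReal_sub, Complex.norm_real,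
    Real.norm_eq_abs] using h2


/-- With the block polynomials `F, G, H` of a rational simple
Harnack parametrization, for all distinct real parameters `t ≠ t'` the vectors
`(F t, G t, H t)` and `(F t', G t', H t')` in `ℂ³` are `ℂ`-linearly independent:
the parametrization is injective on the real locus. -/
theorem rational_harnack_real_locus_embedded
    (d : ℕ) (hd : 1 ≤ d) (a b c : Fin d → ℝ)
    (hab : ∀ i j, a i < b j) (hbc : ∀ j l, b j < c l)
    (F G H : ℂ → ℂ)
    (hF : ∀ x, F x = ∏ i, (x - (a i : ℂ)))
    (hG : ∀ x, G x = ∏ i, (x - (b i : ℂ)))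
    (hH : ∀ x, H x = ∏ i, (x - (c i : ℂ)))
    (t t' : ℝ) (htt' : t ≠ t') :
    LinearIndependent ℂ
      ![![F (t : ℂ), G (t : ℂ), H (t : ℂ)],
        ![F (t' : ℂ), G (t' : ℂ), H (t' : ℂ)]] := by
  rw [LinearIndependent.pair_iff]
  intro p q h
  have hd0 : d ≠ 0 := by omega
  have hPd := Real.rpow_inv_natCast_pow (norm_nonneg p) hd0
  have hQd := Real.rpow_inv_natCast_pow (norm_nonneg q) hd0
  have hP : 0 ≤ ‖p‖ ^ (d : ℝ)⁻¹ := by positivity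
  have hQ : 0 ≤ ‖q‖ ^ (d : ℝ)⁻¹ := by positivity
  generalize ‖p‖ ^ (d : ℝ)⁻¹ = P at hPd hP
  generalize ‖q‖ ^ (d : ℝ)⁻¹ = Q at hQd hQ
  have root : ∀ r : Fin d → ℝ, p * ∏ i, ((t : ℂ) - r i) + q * ∏ i, ((t' : ℂ) - r i) = 0 →
      ∃ i j, ∃ x ∈ Set.uIcc (r i) (r j), P * |t - x| = Q * |t' - x| := fun r hr =>
    exists_mem_uIcc_mul_abs_sub_eq hd r hP hQ (by
      rw [hPd, hQd]
      exact norm_mul_prod_abs_sub_eq r hr)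
  obtain ⟨i, i', x, hx, hfx⟩ := root a (by simpa [hF] using congrFun h 0)
  obtain ⟨j, j', y, hy, hfy⟩ := root b (by simpa [hG] using congrFun h 1)
  obtain ⟨k, k', z, hz, hfz⟩ := root c (by simpa [hH] using congrFun h 2)
  have hxy : x < y := hx.2.trans_lt ((max_lt (lt_min (hab i j) (hab i j'))
    (lt_min (hab i' j) (hab i' j'))).trans_le hy.1)
  have hyz : y < z := hy.2.trans_lt ((max_lt (lt_min (hbc j k) (hbc j k'))
    (lt_min (hbc j' k) (hbc j' k'))).trans_le hz.1)
  obtain ⟨hP0, hQ0⟩ := eq_zero_of_mul_abs_sub_eq htt' hxy hyz hfx hfy hfz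
  rw [hP0, zero_pow hd0] at hPd
  rw [hQ0, zero_pow hd0] at hQd
  exact ⟨norm_eq_zero.1 hPd.symm, norm_eq_zero.1 hQd.symm⟩
end

section
/- Let d ≥ 1 be an integer and let a_1,…,a_d, b_1,…,b_d, c_1,…,c_d be real numbers with a_i < b_j < c_l for all indices, and F, G, H the corresponding block polynomials. Then for every nonzero vector v ∈ ℂ³, the set {x ∈ ℂ : (F(x), G(x), H(x)) is a ℂ-scalar multiple of v} has at most two elements. In other words, every fiber of the rational simple Harnack parametrization x ↦ [F(x) : G(x) : H(x)] contains at most two points. -/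
/-- Strict monotonicity of nonempty products of nonnegative reals. -/
theorem prod_lt_prod_of_forall_lt {ι : Type*} [Fintype ι] [Nonempty ι] {f g : ι → ℝ}
    (hf : ∀ i, 0 ≤ f i) (h : ∀ i, f i < g i) : ∏ i, f i < ∏ i, g i := by
  by_cases h0 : ∃ i, f i = 0
  · obtain ⟨i, hi⟩ := h0
    rw [Finset.prod_eq_zero (Finset.mem_univ i) hi]
    exact Finset.prod_pos fun j _ => (hf j).trans_lt (h j)
  · push Not at h0
    exact Finset.prod_lt_prod_of_nonempty (fun i _ => (hf i).lt_of_ne' (h0 i))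
      (fun i _ => h i) Finset.univ_nonempty

/-- If the products of the distances of `x` and of the rescaled distances of `y` to a finite
family of reals agree, then the two distances agree at a point of the hull of the family. -/
theorem exists_norm_sub_eq_of_prod_eq {ι : Type*} [Fintype ι] [Nonempty ι] (a : ι → ℝ)
    (x y : ℂ) {r : ℝ} (hr : 0 ≤ r)
    (h : ∏ i, ‖x - a i‖ = ∏ i, (r * ‖y - a i‖)) :
    ∃ t : ℝ, (∃ i, a i ≤ t) ∧ (∃ j, t ≤ a j) ∧ ‖x - t‖ = r * ‖y - t‖ := by
  obtain ⟨i, hi⟩ : ∃ i, ‖x - a i‖ ≤ r * ‖y - a i‖ := by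
    by_contra! hlt
    exact (prod_lt_prod_of_forall_lt (fun i => by positivity) hlt).ne' h
  obtain ⟨j, hj⟩ : ∃ j, r * ‖y - a j‖ ≤ ‖x - a j‖ := by
    by_contra! hlt
    exact (prod_lt_prod_of_forall_lt (fun i => by positivity) hlt).ne h
  have hcont : ContinuousOn (fun t : ℝ => ‖x - t‖ - r * ‖y - t‖) (Set.uIcc (a i) (a j)) := by
    fun_prop
  obtain ⟨t, ht, ht0⟩ := intermediate_value_uIcc hcont
    (Set.mem_uIcc_of_le (sub_nonpos.2 hi) (sub_nonneg.2 hj))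
  refine ⟨t, ?_, ?_, sub_eq_zero.1 ht0⟩ <;>
    rcases Set.mem_uIcc.1 ht with ⟨h1, h2⟩ | ⟨h1, h2⟩
  exacts [⟨i, h1⟩, ⟨j, h1⟩, ⟨j, h2⟩, ⟨i, h2⟩]

/-- A real quadratic polynomial with three distinct roots vanishes. -/
theorem quadratic_coeffs_eq_zero {p q r s t u : ℝ} (hst : s < t) (htu : t < u)
    (hs : p * s ^ 2 + q * s + r = 0) (ht : p * t ^ 2 + q * t + r = 0)
    (hu : p * u ^ 2 + q * u + r = 0) : p = 0 ∧ q = 0 ∧ r = 0 := by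
  have h1 : p * (t + s) + q = 0 :=
    mul_left_cancel₀ (sub_pos.2 hst).ne' (by linear_combination ht - hs)
  have h2 : p * (u + t) + q = 0 :=
    mul_left_cancel₀ (sub_pos.2 htu).ne' (by linear_combination hu - ht)
  have hp : p = 0 :=
    mul_left_cancel₀ (sub_pos.2 (hst.trans htu)).ne' (by linear_combination h2 - h1)
  subst hp
  have hq : q = 0 := by linarith
  subst hq
  exact ⟨rfl, rfl, by linarith⟩

/-- Two complex numbers whose distances to three distinct reals are in a constant ratio are
equal or conjugate. -/
theorem eq_or_eq_conj_of_norm_sub_eq {x y : ℂ} {r s t u : ℝ} (hst : s < t) (htu : t < u)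
    (hs : ‖x - s‖ = r * ‖y - s‖) (ht : ‖x - t‖ = r * ‖y - t‖)
    (hu : ‖x - u‖ = r * ‖y - u‖) : y = x ∨ y = (starRingEnd ℂ) x := by
  have key : ∀ w : ℝ, ‖x - w‖ = r * ‖y - w‖ →
      (1 - r ^ 2) * w ^ 2 + (-2 * (x.re - r ^ 2 * y.re)) * w +
        (x.re ^ 2 + x.im ^ 2 - r ^ 2 * (y.re ^ 2 + y.im ^ 2)) = 0 := by
    intro w hw
    have h := congrArg (· ^ 2) hw
    simp only [mul_pow, Complex.sq_norm, Complex.normSq_apply, Complex.sub_re, Complex.sub_im,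
      Complex.ofReal_re, Complex.ofReal_im] at h
    linear_combination h
  obtain ⟨h1, h2, h3⟩ := quadratic_coeffs_eq_zero hst htu (key s hs) (key t ht) (key u hu)
  have hr : r ^ 2 = 1 := by linarith
  rw [hr] at h2 h3
  have hre : y.re = x.re := by linarith
  rw [hre] at h3
  rcases sq_eq_sq_iff_eq_or_eq_neg.1 (show y.im ^ 2 = x.im ^ 2 by linarith) with him | him
  · exact Or.inl (Complex.ext hre him)
  · exact Or.inr (Complex.ext hre (by simpa using him))


/-- With the block polynomials `F, G, H` of a rational simple
Harnack parametrization, for every nonzero vector `v ∈ ℂ³` the set of parameters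
`x ∈ ℂ` at which `(F x, G x, H x)` is a `ℂ`-scalar multiple of `v` has at most two
elements: every fiber of `x ↦ [F x : G x : H x]` contains at most two points. -/
theorem rational_harnack_fibers_le_two
    (d : ℕ) (hd : 1 ≤ d) (a b c : Fin d → ℝ)
    (hab : ∀ i j, a i < b j) (hbc : ∀ j l, b j < c l)
    (F G H : ℂ → ℂ)
    (hF : ∀ x, F x = ∏ i, (x - (a i : ℂ)))
    (hG : ∀ x, G x = ∏ i, (x - (b i : ℂ)))
    (hH : ∀ x, H x = ∏ i, (x - (c i : ℂ)))
    (v : Fin 3 → ℂ) (hv : v ≠ 0) :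
    ∃ u w : ℂ, {x : ℂ | ∃ l : ℂ, ![F x, G x, H x] = l • v} ⊆ {u, w} := by
  have : Nonempty (Fin d) := ⟨⟨0, hd⟩⟩
  rcases Set.eq_empty_or_nonempty {x : ℂ | ∃ l : ℂ, ![F x, G x, H x] = l • v} with he | ⟨x, l, hx⟩
  · exact ⟨0, 0, he ▸ Set.empty_subset _⟩
  refine ⟨x, (starRingEnd ℂ) x, ?_⟩
  rintro y ⟨m, hy⟩
  have hm : m ≠ 0 := by
    rintro rfl
    have hF0 : ∏ i, (y - (a i : ℂ)) = 0 := by simpa [hF] using congrFun hy 0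
    have hG0 : ∏ i, (y - (b i : ℂ)) = 0 := by simpa [hG] using congrFun hy 1
    obtain ⟨i, -, hi⟩ := Finset.prod_eq_zero_iff.1 hF0
    obtain ⟨j, -, hj⟩ := Finset.prod_eq_zero_iff.1 hG0
    have hij : (a i : ℂ) = b j := (sub_eq_zero.1 hi).symm.trans (sub_eq_zero.1 hj)
    exact (hab i j).ne (Complex.ofReal_injective hij)
  obtain ⟨r, hr, hrd⟩ : ∃ r : ℝ, 0 ≤ r ∧ r ^ d = ‖l / m‖ :=
    ⟨‖l / m‖ ^ (d⁻¹ : ℝ), by positivity, Real.rpow_inv_natCast_pow (norm_nonneg _) (by lia)⟩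
  have hxy : ![F x, G x, H x] = (l / m) • ![F y, G y, H y] := by
    rw [hx, hy, smul_smul, div_mul_cancel₀ _ hm]
  have hprod : ∀ e : Fin d → ℝ,
      ∏ i, (x - (e i : ℂ)) = l / m * ∏ i, (y - (e i : ℂ)) →
        ∏ i, ‖x - e i‖ = ∏ i, (r * ‖y - e i‖) := by
    intro e he
    simpa [Finset.prod_mul_distrib, hrd, norm_prod] using congrArg norm he
  obtain ⟨s, -, ⟨i, hi⟩, hs⟩ := exists_norm_sub_eq_of_prod_eq a x y hr
    (hprod a (by simpa [hF] using congrFun hxy 0))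
  obtain ⟨t, ⟨j, hj⟩, ⟨k, hk⟩, ht⟩ := exists_norm_sub_eq_of_prod_eq b x y hr
    (hprod b (by simpa [hG] using congrFun hxy 1))
  obtain ⟨u, ⟨n, hn⟩, -, hu⟩ := exists_norm_sub_eq_of_prod_eq c x y hr
    (hprod c (by simpa [hH] using congrFun hxy 2))
  exact eq_or_eq_conj_of_norm_sub_eq (by linarith [hab i j]) (by linarith [hbc k n]) hs ht hu
end
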